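/- Fix 0<c<∞, an integer d≥3, and an integer k≥1. There exist δ>0 and ε>0 (depending only on c, d, k) such that for all n sufficiently large, for the KCIP on Λ(L,d) with p=c/n started from any x∈Ω_k: P[ρ_{k+1} < εn³ | X_0 = x] > δ, and, if k≥2, also P[ρ_{k−1} < εn³ | X_0 = x] > δ, where ρ_j = inf{t : X_t ∈ Ω_j}. -/

import Mathlib

open scoped Classical
open Finset

noncomputable section

/-- The number of particles (vertices labelled `1`) of a configuration. -/
def numParticles {V : Type*} [Fintype V] (x : V → Bool) : ℕ :=
  (Finset.univ.filter fun v => x v = true).card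

/-- One-step transition kernel of the kinetically constrained Ising process (KCIP)
on the graph `G` with density parameter `p`: a uniformly chosen vertex `v` is updated,
and its label is resampled (to `1` with probability `p`, to `0` otherwise) iff `v` has at
least one neighbour labelled `1`. -/
def kcipKernel {V : Type*} [Fintype V] (G : SimpleGraph V) (p : ℝ) (x y : V → Bool) : ℝ :=
  ((Fintype.card V : ℝ))⁻¹ * ∑ v : V,
    (if ∀ w, w ≠ v → y w = x w then
      (if ∃ u, G.Adj u v ∧ x u = true then (if y v = true then p else 1 - p)
       else (if y v = x v then 1 else 0))
     else 0)

/-- Probability that the Markov chain with kernel `K` started at `x` produces a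
trajectory `(X_0, …, X_T)` lying in the event `A`. -/
def trajProb {Ω : Type*} [Fintype Ω] (K : Ω → Ω → ℝ) (x : Ω) (T : ℕ)
    (A : (Fin (T + 1) → Ω) → Prop) : ℝ :=
  ∑ ω : Fin (T + 1) → Ω,
    if ω 0 = x ∧ A ω then ∏ i : Fin T, K (ω i.castSucc) (ω i.succ) else 0

/-- Expectation of a functional `f` of the trajectory `(X_0, …, X_T)` of the Markov chain
with kernel `K` started at `x`. -/
def trajExp {Ω : Type*} [Fintype Ω] (K : Ω → Ω → ℝ) (x : Ω) (T : ℕ)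
    (f : (Fin (T + 1) → Ω) → ℝ) : ℝ :=
  ∑ ω : Fin (T + 1) → Ω,
    (if ω 0 = x then ∏ i : Fin T, K (ω i.castSucc) (ω i.succ) else 0) * f ω

/-- The `d`-dimensional discrete torus `Z_L^d`: vertices are `Fin d → ZMod L`, with an edge
between `u` and `v` iff `u - v = ± e_i` for some coordinate vector `e_i`. -/
def torusGraph (L d : ℕ) : SimpleGraph (Fin d → ZMod L) :=
  SimpleGraph.fromRel fun u v => ∃ i : Fin d, v = u + fun j => if j = i then (1 : ZMod L) else 0

/-- `Ω_k`: configurations with exactly `k` particles, no two of which are adjacent. -/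
def OmegaK {V : Type*} [Fintype V] (G : SimpleGraph V) (k : ℕ) : Set (V → Bool) :=
  {x | numParticles x = k ∧ ∀ u v, G.Adj u v → ¬(x u = true ∧ x v = true)}

lemma trajProb_succ {Ω : Type*} [Fintype Ω] (K : Ω → Ω → ℝ) (x : Ω) (T : ℕ)
    (A : (Fin (T + 2) → Ω) → Prop) :
    trajProb K x (T + 1) A =
      ∑ y, K x y * trajProb K y T (fun ω => A (Fin.cons x ω : Fin (T + 2) → Ω)) := by
  have h1 : trajProb K x (T + 1) A =
      ∑ a : Ω, ∑ ω : Fin (T + 1) → Ω, if a = x ∧ A (Fin.cons a ω : Fin (T + 2) → Ω) then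
        K a (ω 0) * ∏ i : Fin T, K (ω i.castSucc) (ω i.succ) else 0 := by
    unfold trajProb
    rw [← (Fin.consEquiv (fun _ : Fin (T + 2) => Ω)).sum_comp, Fintype.sum_prod_type]
    refine Finset.sum_congr rfl fun a _ => Finset.sum_congr rfl fun ω _ => ?_
    simp only [Fin.consEquiv, Equiv.coe_fn_mk, Fin.cons_zero, Fin.prod_univ_succ,
      Fin.castSucc_zero, Fin.cons_succ]
    rfl
  rw [h1, Finset.sum_eq_single x]
  · simp only [true_and, trajProb, Finset.mul_sum]
    rw [Finset.sum_comm]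
    refine Finset.sum_congr rfl fun ω _ => ?_
    rw [Finset.sum_eq_single (ω 0)]
    · simp
    · intro b _ hb
      simp [Ne.symm hb]
    · simp
  · intro a _ ha
    simp [ha]
  · simp

lemma trajProb_nonneg {Ω : Type*} [Fintype Ω] {K : Ω → Ω → ℝ} (hK : ∀ x y, 0 ≤ K x y)
    (x : Ω) (T : ℕ) (A : (Fin (T + 1) → Ω) → Prop) : 0 ≤ trajProb K x T A := by
  unfold trajProb
  refine Finset.sum_nonneg fun ω _ => ?_
  split_ifs
  · exact Finset.prod_nonneg fun i _ => hK _ _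
  · exact le_rfl

lemma trajProb_true {Ω : Type*} [Fintype Ω] {K : Ω → Ω → ℝ} (hK1 : ∀ x, ∑ y, K x y = 1)
    (x : Ω) (T : ℕ) : trajProb K x T (fun _ => True) = 1 := by
  induction T generalizing x with
  | zero =>
    unfold trajProb
    rw [← (Equiv.funUnique (Fin 1) Ω).symm.sum_comp]
    simp
  | succ T ih =>
    rw [trajProb_succ]
    simp [ih, hK1]

/-- A bounded function growing by the factor `1 + r` on average in every step outside `A`
(where it is positive) forces the chain to enter `A`. -/
lemma trajProb_hit_ge {Ω : Type*} [Fintype Ω] {K : Ω → Ω → ℝ} (hK : ∀ x y, 0 ≤ K x y)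
    (hK1 : ∀ x, ∑ y, K x y = 1) (A : Set Ω) (φ : Ω → ℝ) (r : ℝ) (hr : 0 ≤ r)
    (hφ1 : ∀ x, φ x ≤ 1)
    (hφ : ∀ x, x ∉ A → 0 < φ x → (1 + r) * φ x ≤ ∑ y, K x y * φ y) (x : Ω) (T : ℕ) :
    φ x - (1 + r) / (1 + r) ^ T ≤
      trajProb K x T (fun ω => ∃ t : Fin (T + 1), (t : ℕ) < T ∧ ω t ∈ A) := by
  induction T generalizing x with
  | zero =>
    have h0 := trajProb_nonneg hK x 0 (fun ω => ∃ t : Fin (0 + 1), (t : ℕ) < 0 ∧ ω t ∈ A)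
    have := hφ1 x
    simp only [pow_zero, div_one]
    linarith
  | succ T ih =>
    have hpos : (0 : ℝ) < (1 + r) ^ T := by positivity
    have h0 := trajProb_nonneg hK x (T + 1)
      (fun ω => ∃ t : Fin (T + 1 + 1), (t : ℕ) < T + 1 ∧ ω t ∈ A)
    have hb : (1 + r) / (1 + r) ^ (T + 1) = 1 / (1 + r) ^ T := by
      rw [pow_succ]; field_simp
    rw [hb]
    by_cases hx : x ∈ A
    · have : trajProb K x (T + 1)
          (fun ω => ∃ t : Fin (T + 1 + 1), (t : ℕ) < T + 1 ∧ ω t ∈ A) = 1 := by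
        rw [trajProb_succ, ← hK1 x]
        refine Finset.sum_congr rfl fun y _ => ?_
        conv_rhs => rw [← mul_one (K x y), ← trajProb_true hK1 y T]
        congr 2
        funext ω
        simp only [eq_iff_iff, iff_true]
        exact ⟨0, by simp, by simpa using hx⟩
      rw [this]
      have := hφ1 x
      have : 0 ≤ 1 / (1 + r) ^ T := by positivity
      linarith
    · by_cases hφx : φ x ≤ 1 / (1 + r) ^ T
      · linarith
      · push Not at hφx
        have hp : 0 < φ x := lt_of_le_of_lt (by positivity) hφx
        have h2 : trajProb K x (T + 1)
            (fun ω => ∃ t : Fin (T + 1 + 1), (t : ℕ) < T + 1 ∧ ω t ∈ A) =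
            ∑ y, K x y * trajProb K y T
              (fun ω => ∃ t : Fin (T + 1), (t : ℕ) < T ∧ ω t ∈ A) := by
          rw [trajProb_succ]
          refine Finset.sum_congr rfl fun y _ => ?_
          congr 2
          funext ω
          rw [Fin.exists_fin_succ]
          simp [hx]
        rw [h2]
        have h3 : ∑ y, K x y * (φ y - (1 + r) / (1 + r) ^ T) ≤
            ∑ y, K x y * trajProb K y T
              (fun ω => ∃ t : Fin (T + 1), (t : ℕ) < T ∧ ω t ∈ A) :=
          Finset.sum_le_sum fun y _ => mul_le_mul_of_nonneg_left (ih y) (hK x y)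
        refine le_trans ?_ h3
        simp only [mul_sub, Finset.sum_sub_distrib, ← Finset.sum_mul, hK1, one_mul]
        have h4 := hφ x hx hp
        have h5 : (1 + r) / (1 + r) ^ T = 1 / (1 + r) ^ T + r * (1 / (1 + r) ^ T) := by
          field_simp
        nlinarith

lemma sum_kcipKernel_mul {V : Type*} [Fintype V] (G : SimpleGraph V) (p : ℝ)
    (x : V → Bool) (g : (V → Bool) → ℝ) :
    ∑ y, kcipKernel G p x y * g y = ((Fintype.card V : ℝ))⁻¹ * ∑ v,
      (if ∃ u, G.Adj u v ∧ x u = true then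
        p * g (Function.update x v true) + (1 - p) * g (Function.update x v false)
      else g x) := by
  unfold kcipKernel
  simp only [mul_assoc, Finset.sum_mul, ← Finset.mul_sum]
  rw [Finset.sum_comm]
  congr 1
  refine Finset.sum_congr rfl fun v _ => ?_
  have hsub : ∑ y : V → Bool, (if ∀ w, w ≠ v → y w = x w then
      (if ∃ u, G.Adj u v ∧ x u = true then (if y v = true then p else 1 - p)
       else (if y v = x v then 1 else 0)) else 0) * g y =
      ∑ y ∈ ({Function.update x v true, Function.update x v false} : Finset (V → Bool)),
      (if ∀ w, w ≠ v → y w = x w then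
      (if ∃ u, G.Adj u v ∧ x u = true then (if y v = true then p else 1 - p)
       else (if y v = x v then 1 else 0)) else 0) * g y := by
    symm
    refine Finset.sum_subset (Finset.subset_univ _) fun y _ hy => ?_
    rw [if_neg, zero_mul]
    intro h
    apply hy
    have : y = Function.update x v (y v) := by
      funext w
      by_cases hw : w = v
      · subst hw; simp
      · simp [hw, h w hw]
    rw [this]
    cases y v <;> simp
  rw [hsub, Finset.sum_pair]
  · have h1 : ∀ b w, w ≠ v → Function.update x v b w = x w := fun b w hw => by simp [hw]
    rw [if_pos (h1 true), if_pos (h1 false)]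
    simp only [Function.update_self]
    split_ifs with h2 h3 h4 h5 h6
    · simp_all
    · simp_all
    · have : Function.update x v true = x := by rw [h4]; simp
      rw [← h4] at h5; cases h5
    · have : Function.update x v true = x := by rw [h4]; simp
      rw [this]; ring
    · have : Function.update x v false = x := by rw [h6]; simp
      rw [this]; ring
    · exfalso; cases hxv : x v <;> simp_all
  · intro h
    have := congrFun h v
    simp at this

lemma kcipKernel_nonneg {V : Type*} [Fintype V] (G : SimpleGraph V) {p : ℝ} (hp : 0 ≤ p)
    (hp1 : p ≤ 1) (x y : V → Bool) : 0 ≤ kcipKernel G p x y := by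
  unfold kcipKernel
  refine mul_nonneg (by positivity) (Finset.sum_nonneg fun v _ => ?_)
  split_ifs <;> linarith

lemma sum_kcipKernel {V : Type*} [Fintype V] [Nonempty V] (G : SimpleGraph V) (p : ℝ)
    (x : V → Bool) : ∑ y, kcipKernel G p x y = 1 := by
  have := sum_kcipKernel_mul G p x (fun _ => 1)
  simp only [mul_one] at this
  rw [this]
  have h : ∀ v : V, (if ∃ u, G.Adj u v ∧ x u = true then p + (1 - p) else 1) = 1 := by
    intro v; split_ifs <;> ring
  simp only [h]
  simp

/-- The set of vertices labelled `1`. -/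
def particles {V : Type*} [Fintype V] (x : V → Bool) : Finset V :=
  Finset.univ.filter fun v => x v = true

/-- The particles with a neighbouring particle. -/
def activeSet {V : Type*} (G : SimpleGraph V) (X : Finset V) : Finset V :=
  X.filter fun v => ∃ u ∈ X, G.Adj u v

/-- The empty vertices with a neighbouring particle. -/
def boundarySet {V : Type*} [Fintype V] (G : SimpleGraph V) (X : Finset V) : Finset V :=
  Finset.univ.filter fun v => v ∉ X ∧ ∃ u ∈ X, G.Adj u v

lemma sum_kcipKernel_particles {V : Type*} [Fintype V] [Nonempty V] (G : SimpleGraph V) (p : ℝ)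
    (x : V → Bool) (φ : Finset V → ℝ) :
    ∑ y, kcipKernel G p x y * φ (particles y) =
      φ (particles x) + ((Fintype.card V : ℝ))⁻¹ *
        (p * ∑ v ∈ boundarySet G (particles x),
            (φ (insert v (particles x)) - φ (particles x)) +
          (1 - p) * ∑ v ∈ activeSet G (particles x),
            (φ ((particles x).erase v) - φ (particles x))) := by
  rw [sum_kcipKernel_mul G p x (fun y => φ (particles y))]
  have hn : (Fintype.card V : ℝ) ≠ 0 := by simp
  have ht : ∀ v, particles (Function.update x v true) = insert v (particles x) := by
    intro v; ext w; by_cases h : w = v <;> simp [particles, h]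
  have hf : ∀ v, particles (Function.update x v false) = (particles x).erase v := by
    intro v; ext w; by_cases h : w = v <;> simp [particles, h]
  simp only [ht, hf]
  have hS : activeSet G (particles x) =
      Finset.univ.filter fun v => v ∈ particles x ∧ ∃ u ∈ particles x, G.Adj u v := by
    ext v; simp [activeSet]
  rw [hS, boundarySet, Finset.sum_filter, Finset.sum_filter, Finset.mul_sum _ _ p,
    Finset.mul_sum _ _ (1 - p), ← Finset.sum_add_distrib]
  have hφ : φ (particles x) = ((Fintype.card V : ℝ))⁻¹ * ∑ _v : V, φ (particles x) := by
    simp [hn]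
  conv_rhs => enter [1]; rw [hφ]
  rw [← mul_add, ← Finset.sum_add_distrib]
  congr 1
  refine Finset.sum_congr rfl fun v _ => ?_
  have hiff : (∃ u, G.Adj u v ∧ x u = true) ↔ ∃ u ∈ particles x, G.Adj u v := by
    simp [particles, and_comm]
  by_cases h : ∃ u ∈ particles x, G.Adj u v
  · rw [if_pos (hiff.2 h)]
    by_cases hv : v ∈ particles x
    · simp only [hv, h, not_true_eq_false, false_and, true_and, if_true, if_false,
        Finset.insert_eq_of_mem hv]
      ring
    · simp only [hv, h, not_false_eq_true, false_and, true_and, if_true, if_false,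
        Finset.erase_eq_of_notMem hv]
      ring
  · rw [if_neg (fun h' => h (hiff.1 h'))]
    simp [h]

/-- Expected value of `f` at the end of the pure death dynamics which removes, one at a time, a
uniformly chosen particle having a neighbouring particle. -/
def deathAvg {V : Type*} (G : SimpleGraph V) (f : Finset V → ℝ) (X : Finset V) : ℝ :=
  if activeSet G X = ∅ then f X
  else (∑ u ∈ (activeSet G X).attach, deathAvg G f (X.erase u.1)) / (activeSet G X).card
termination_by X.card
decreasing_by exact Finset.card_erase_lt_of_mem (Finset.mem_filter.1 u.2).1

section DeathAvg

variable {V : Type*} {G : SimpleGraph V} {f : Finset V → ℝ}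

lemma deathAvg_of_stable {X : Finset V} (h : activeSet G X = ∅) : deathAvg G f X = f X := by
  rw [deathAvg, if_pos h]

lemma card_mul_deathAvg {X : Finset V} (h : activeSet G X ≠ ∅) :
    ((activeSet G X).card : ℝ) * deathAvg G f X =
      ∑ u ∈ activeSet G X, deathAvg G f (X.erase u) := by
  rw [deathAvg, if_neg h, Finset.sum_attach (activeSet G X) (fun u => deathAvg G f (X.erase u))]
  have : ((activeSet G X).card : ℝ) ≠ 0 := by
    simpa using h
  field_simp

lemma deathAvg_nonneg (hf : ∀ X, 0 ≤ f X) (X : Finset V) : 0 ≤ deathAvg G f X := by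
  induction hX : X.card using Nat.strong_induction_on generalizing X with
  | _ j ih =>
    rw [deathAvg]
    split_ifs with h
    · exact hf X
    · refine div_nonneg (Finset.sum_nonneg fun u _ => ?_) (by positivity)
      exact ih _ (hX ▸ Finset.card_erase_lt_of_mem (Finset.mem_filter.1 u.2).1) _ rfl

lemma deathAvg_le {M : ℝ} (hf : ∀ X, f X ≤ M) (X : Finset V) : deathAvg G f X ≤ M := by
  induction hX : X.card using Nat.strong_induction_on generalizing X with
  | _ j ih =>
    by_cases h : activeSet G X = ∅
    · rw [deathAvg_of_stable h]; exact hf X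
    · have h1 := card_mul_deathAvg (f := f) h
      have hpos : (0 : ℝ) < (activeSet G X).card := by
        exact_mod_cast Finset.card_pos.2 (Finset.nonempty_iff_ne_empty.2 h)
      have h2 : ∑ u ∈ activeSet G X, deathAvg G f (X.erase u) ≤ (activeSet G X).card * M := by
        rw [← nsmul_eq_mul]
        refine Finset.sum_le_card_nsmul _ _ _ fun u hu => ?_
        exact ih _ (hX ▸ Finset.card_erase_lt_of_mem (Finset.mem_filter.1 hu).1) _ rfl
      rw [← h1] at h2
      exact le_of_mul_le_mul_left h2 hpos

lemma deathAvg_ge_erase (hf : ∀ X, 0 ≤ f X) {X : Finset V} {v : V} (hv : v ∈ activeSet G X) :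
    deathAvg G f (X.erase v) / X.card ≤ deathAvg G f X := by
  have hne : activeSet G X ≠ ∅ := Finset.ne_empty_of_mem hv
  have h1 := card_mul_deathAvg (f := f) hne
  have hvX : v ∈ X := (Finset.mem_filter.1 hv).1
  have hpos : (0 : ℝ) < X.card := by exact_mod_cast Finset.card_pos.2 ⟨v, hvX⟩
  have hle : ((activeSet G X).card : ℝ) ≤ X.card := by
    exact_mod_cast Finset.card_le_card (Finset.filter_subset _ _)
  have h2 : deathAvg G f (X.erase v) ≤ ∑ u ∈ activeSet G X, deathAvg G f (X.erase u) :=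
    Finset.single_le_sum (f := fun u => deathAvg G f (X.erase u))
      (fun u _ => deathAvg_nonneg hf _) hv
  rw [div_le_iff₀ hpos]
  have := deathAvg_nonneg (G := G) hf X
  nlinarith

end DeathAvg

lemma card_boundarySet_le {V : Type*} [Fintype V] {G : SimpleGraph V} {D : ℕ}
    (hD : ∀ u, (Finset.univ.filter fun v => G.Adj u v).card ≤ D) (X : Finset V) :
    (boundarySet G X).card ≤ D * X.card := by
  have hsub : boundarySet G X ⊆ X.biUnion fun u => Finset.univ.filter fun v => G.Adj u v := by
    intro v hv
    simp only [boundarySet, Finset.mem_filter, Finset.mem_univ, true_and] at hv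
    simpa using hv.2
  calc (boundarySet G X).card ≤ _ := Finset.card_le_card hsub
    _ ≤ X.card * D := Finset.card_biUnion_le_card_mul _ _ _ fun u _ => hD u
    _ = _ := mul_comm _ _

/-- Configurations of fewer than `J` particles in which some birth multiplies the expected
final value of `f` by at least `Θ`. -/
def HasGoodBirth {V : Type*} [Fintype V] (G : SimpleGraph V) (f : Finset V → ℝ) (J : ℕ) (Θ : ℝ)
    (X : Finset V) : Prop :=
  X.card < J ∧ ∃ w ∈ boundarySet G X, Θ * deathAvg G f X ≤ deathAvg G f (insert w X)

/-- The extension of a function `f` of stable configurations to all configurations with at most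
`J` particles, corrected at order `1 / n`. -/
def corrected {V : Type*} [Fintype V] (G : SimpleGraph V) (f : Finset V → ℝ) (J : ℕ)
    (C b Θ : ℝ) (X : Finset V) : ℝ :=
  if J < X.card then 0
  else if activeSet G X = ∅ then f X
  else (1 - C * X.card / Fintype.card V +
    if HasGoodBirth G f J Θ X then b / Fintype.card V else 0) * deathAvg G f X

section Corrected

variable {V : Type*} [Fintype V] [Nonempty V] {G : SimpleGraph V} {f : Finset V → ℝ} {J D : ℕ}
  {c C b Θ : ℝ}

lemma corrected_ge (hf : ∀ X, 0 ≤ f X) (hC : 0 ≤ C) (hb : 0 ≤ b) {X : Finset V}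
    (hX : X.card ≤ J) :
    (1 - C * X.card / Fintype.card V) * deathAvg G f X ≤ corrected G f J C b Θ X := by
  have h0 := deathAvg_nonneg (G := G) hf X
  have h1 : 0 ≤ C * X.card / Fintype.card V := by positivity
  have h2 : 0 ≤ b / Fintype.card V := by positivity
  unfold corrected
  rw [if_neg (by omega)]
  split_ifs with h h'
  · rw [deathAvg_of_stable h] at h0 ⊢
    nlinarith
  · nlinarith
  · simp

lemma corrected_nonneg (hf : ∀ X, 0 ≤ f X) (hC : 0 ≤ C) (hb : 0 ≤ b)
    (hn : 2 * (C * J) ≤ Fintype.card V) (X : Finset V) : 0 ≤ corrected G f J C b Θ X := by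
  by_cases hX : J < X.card
  · simp [corrected, hX]
  · push Not at hX
    refine le_trans (mul_nonneg ?_ (deathAvg_nonneg hf X)) (corrected_ge hf hC hb hX)
    have hpos : (0 : ℝ) < Fintype.card V := by exact_mod_cast Fintype.card_pos
    rw [sub_nonneg, div_le_one hpos]
    have h1 : C * X.card ≤ C * J := by gcongr
    have h2 : 0 ≤ C * X.card := by positivity
    linarith

lemma corrected_le (hf : ∀ X, 0 ≤ f X) (hC : 0 ≤ C) (hbn : b ≤ Fintype.card V)
    (X : Finset V) : corrected G f J C b Θ X ≤ 2 * deathAvg G f X := by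
  have h0 := deathAvg_nonneg (G := G) hf X
  have hpos : (0 : ℝ) < Fintype.card V := by exact_mod_cast Fintype.card_pos
  have h1 : 0 ≤ C * X.card / Fintype.card V := by positivity
  have h2 : b / Fintype.card V ≤ 1 := by rw [div_le_one hpos]; exact hbn
  unfold corrected
  split_ifs with h h' h''
  · linarith
  · rw [deathAvg_of_stable h'] at h0 ⊢; linarith
  · nlinarith
  · nlinarith

set_option maxHeartbeats 1000000 in
lemma corrected_step_of_unstable (hf : ∀ X, 0 ≤ f X) (hc : 0 < c)
    (hD : ∀ u, (Finset.univ.filter fun v => G.Adj u v).card ≤ D) (hC : C = 4 * c * D * J + 2)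
    (hb : 0 ≤ b) (hbΘ : 2 * J * b ≤ c * Θ) (hn : 2 * (C * J) ≤ Fintype.card V)
    (hcn : 2 * c ≤ Fintype.card V) (hbn : b ≤ Fintype.card V) {X : Finset V}
    (hX : activeSet G X ≠ ∅) (hXJ : X.card ≤ J) :
    ((Fintype.card V : ℝ))⁻¹ * deathAvg G f X ≤
      c / Fintype.card V * ∑ v ∈ boundarySet G X,
          (corrected G f J C b Θ (insert v X) - corrected G f J C b Θ X) +
        (1 - c / Fintype.card V) * ∑ v ∈ activeSet G X,
          (corrected G f J C b Θ (X.erase v) - corrected G f J C b Θ X) := by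
  set φ := corrected G f J C b Θ with hφ
  have hC0 : 0 ≤ C := by rw [hC]; positivity
  have hnn := corrected_nonneg (G := G) (Θ := Θ) hf hC0 hb hn
  rw [← hφ] at hnn
  have hge : ∀ Y : Finset V, Y.card ≤ J → _ :=
    fun Y hY => corrected_ge (G := G) (Θ := Θ) hf hC0 hb hY
  rw [← hφ] at hge
  have hle := corrected_le (G := G) (J := J) (Θ := Θ) hf hC0 hbn X
  rw [← hφ] at hle
  have hd0 := deathAvg_nonneg (G := G) hf X
  set n : ℝ := (Fintype.card V : ℝ) with hndef
  have hpos : (0 : ℝ) < n := by rw [hndef]; exact_mod_cast Fintype.card_pos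
  set d := deathAvg G f X with hd
  set m : ℝ := ((activeSet G X).card : ℝ) with hm
  have hm1 : 1 ≤ m := by
    rw [hm]; exact_mod_cast Finset.card_pos.2 (Finset.nonempty_iff_ne_empty.2 hX)
  have hXJ' : (X.card : ℝ) ≤ J := by exact_mod_cast hXJ
  have hmJ : m ≤ J := by
    refine le_trans ?_ hXJ'
    rw [hm]; exact_mod_cast Finset.card_le_card (Finset.filter_subset _ _)
  have hbd : ((boundarySet G X).card : ℝ) ≤ D * J := by
    have h1 := card_boundarySet_le hD X
    have h2 : ((boundarySet G X).card : ℝ) ≤ D * X.card := by exact_mod_cast h1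
    exact h2.trans (by gcongr)
  -- deaths
  have hdeath : (1 - C * ((X.card : ℝ) - 1) / n) * (m * d) ≤ ∑ v ∈ activeSet G X, φ (X.erase v) := by
    rw [hm, hd, card_mul_deathAvg hX, Finset.mul_sum]
    refine Finset.sum_le_sum fun v hv => ?_
    have hvX : v ∈ X := (Finset.mem_filter.1 hv).1
    have := hge (X.erase v) (by have := Finset.card_erase_le (s := X) (a := v); omega)
    rw [Finset.card_erase_of_mem hvX, Nat.cast_sub (Finset.card_pos.2 ⟨v, hvX⟩)] at this
    simpa using this
  obtain ⟨β, hβ0, hφX, hbirth⟩ : ∃ β : ℝ, 0 ≤ β ∧ φ X = (1 - C * X.card / n + β) * d ∧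
      (J * β * n / c - D * J * 2) * d ≤ ∑ v ∈ boundarySet G X, (φ (insert v X) - φ X) := by
    have hsum : ∑ v ∈ boundarySet G X, φ (insert v X) - D * J * (2 * d) ≤
        ∑ v ∈ boundarySet G X, (φ (insert v X) - φ X) := by
      rw [Finset.sum_sub_distrib, Finset.sum_const, nsmul_eq_mul]
      have : ((boundarySet G X).card : ℝ) * φ X ≤ D * J * (2 * d) := by
        gcongr
        exact hnn X
      linarith
    by_cases hg : HasGoodBirth G f J Θ X
    · refine ⟨b / n, by positivity, ?_, ?_⟩
      · rw [hφ, corrected, if_neg (by omega), if_neg hX, if_pos hg]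
      · obtain ⟨hlt, w, hw, hwΘ⟩ := hg
        have h1 : φ (insert w X) ≤ ∑ v ∈ boundarySet G X, φ (insert v X) :=
          Finset.single_le_sum (f := fun v => φ (insert v X)) (fun v _ => hnn _) hw
        have hwX : w ∉ X := (Finset.mem_filter.1 hw).2.1
        have hcard : (insert w X).card ≤ J := by
          rw [Finset.card_insert_of_notMem hwX]; omega
        have h2 := hge (insert w X) hcard
        have h3 : 1 / 2 ≤ 1 - C * ((insert w X).card : ℝ) / n := by
          have : C * ((insert w X).card : ℝ) / n ≤ 1 / 2 := by
            rw [div_le_iff₀ hpos]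
            have : C * ((insert w X).card : ℝ) ≤ C * J := by gcongr
            linarith
          linarith
        have h4 : 0 ≤ deathAvg G f (insert w X) := deathAvg_nonneg hf _
        have h5 : 1 / 2 * (Θ * d) ≤ φ (insert w X) := by nlinarith
        have h6 : J * (b / n) * n / c ≤ Θ / 2 := by
          rw [div_le_iff₀ hc]; field_simp; linarith
        nlinarith
    · refine ⟨0, le_rfl, ?_, ?_⟩
      · rw [hφ, corrected, if_neg (by omega), if_neg hX, if_neg hg]
      · have : 0 ≤ ∑ v ∈ boundarySet G X, φ (insert v X) :=
          Finset.sum_nonneg fun v _ => hnn _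
        simp only [mul_zero, zero_mul, zero_div]
        linarith
  have hdeath' : (C / n - β) * (m * d) ≤ ∑ v ∈ activeSet G X, (φ (X.erase v) - φ X) := by
    rw [Finset.sum_sub_distrib, Finset.sum_const, nsmul_eq_mul, ← hm, hφX]
    have : (1 - C * ((X.card : ℝ) - 1) / n) * (m * d) - m * ((1 - C * X.card / n + β) * d) =
      (C / n - β) * (m * d) := by ring
    linarith
  have hp1 : c / n ≤ 1 / 2 := by rw [div_le_iff₀ hpos]; linarith
  have hp0 : 0 ≤ c / n := by positivity
  have e1 : c / n * ((J * β * n / c - D * J * 2) * d) = (J * β - c * D * J * 2 / n) * d := by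
    field_simp
  have e2 := mul_le_mul_of_nonneg_left hbirth hp0
  have e3 := mul_le_mul_of_nonneg_left hdeath' (by linarith : 0 ≤ 1 - c / n)
  have hmd : d ≤ m * d := by nlinarith
  have hmd' : m * d ≤ J * d := by nlinarith
  have hmd0 : 0 ≤ m * d := by linarith
  have e4 : C / n / 2 * d - J * β * d ≤ (1 - c / n) * ((C / n - β) * (m * d)) := by
    have hCn : 0 ≤ C / n := by positivity
    have q1 : C / n / 2 * d ≤ (1 - c / n) * (C / n * (m * d)) := by
      have h1 : C / n * d ≤ C / n * (m * d) := by gcongr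
      have h2 : 0 ≤ C / n * (m * d) := by positivity
      have h3 := mul_le_mul_of_nonneg_right (by linarith : 1 / 2 ≤ 1 - c / n) h2
      linarith
    have q2 : (1 - c / n) * (β * (m * d)) ≤ J * β * d := by
      have h1 : β * (m * d) ≤ β * (J * d) := by gcongr
      have h2 : 0 ≤ β * (m * d) := by positivity
      have h3 := mul_le_mul_of_nonneg_right (by linarith : 1 - c / n ≤ 1) h2
      linarith
    have q3 : (1 - c / n) * ((C / n - β) * (m * d)) =
        (1 - c / n) * (C / n * (m * d)) - (1 - c / n) * (β * (m * d)) := by ring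
    linarith
  have e5 : C / n / 2 - c * D * J * 2 / n = n⁻¹ := by
    rw [hC]; field_simp; ring
  have e6 : n⁻¹ * d = C / n / 2 * d - c * D * J * 2 / n * d := by rw [← e5]; ring
  have e7 : (J * β - c * D * J * 2 / n) * d = J * β * d - c * D * J * 2 / n * d := by ring
  rw [e6]
  linarith

/-- A drift condition on stable configurations bounds hitting probabilities from below. -/
theorem trajProb_hit_of_drift (hf : ∀ X, 0 ≤ f X) {M : ℝ} (hfM : ∀ X, f X ≤ M) (hM : 0 < M)
    (hc : 0 < c)
    (hD : ∀ u, (Finset.univ.filter fun v => G.Adj u v).card ≤ D) (hC : C = 4 * c * D * J + 2)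
    (hb : 0 ≤ b) (hbΘ : 2 * J * b ≤ c * Θ) (hn : 2 * (C * J) ≤ Fintype.card V)
    (hcn : 2 * c ≤ Fintype.card V) (hbn : b ≤ Fintype.card V) (A : Set (Finset V))
    (hdrift : ∀ S, activeSet G S = ∅ → S ∉ A → 0 < f S → S.card < J ∧
      f S ≤ ∑ v ∈ boundarySet G S, (Fintype.card V * (deathAvg G f (insert v S) - f S) -
        C * J * deathAvg G f (insert v S) +
        if HasGoodBirth G f J Θ (insert v S) then b * deathAvg G f (insert v S) else 0))
    (x : V → Bool) (hx : activeSet G (particles x) = ∅) (hxJ : (particles x).card ≤ J) (T : ℕ) :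
    f (particles x) / (2 * M) - 2 / (1 + T * (c / (Fintype.card V : ℝ) ^ 3)) ≤
      trajProb (kcipKernel G (c / Fintype.card V)) x T
        (fun ω => ∃ t : Fin (T + 1), (t : ℕ) < T ∧ particles (ω t) ∈ A) := by
  set φ := corrected G f J C b Θ with hφ
  have hC0 : 0 ≤ C := by rw [hC]; positivity
  have hnn := corrected_nonneg (G := G) (Θ := Θ) hf hC0 hb hn
  rw [← hφ] at hnn
  have hle := corrected_le (G := G) (J := J) (Θ := Θ) hf hC0 hbn
  rw [← hφ] at hle
  set n : ℝ := (Fintype.card V : ℝ) with hndef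
  have hn1 : (1 : ℝ) ≤ n := by rw [hndef]; exact_mod_cast Fintype.card_pos
  have hpos : (0 : ℝ) < n := by linarith
  set r := c / n ^ 3 with hr
  have hr0 : 0 ≤ r := by positivity
  have hr1 : r ≤ n⁻¹ * n⁻¹ / 2 := by
    rw [hr, div_le_iff₀ (by positivity)]
    have : n⁻¹ * n⁻¹ / 2 * n ^ 3 = n / 2 := by field_simp
    rw [this]; linarith
  have hr2 : r ≤ 1 := by
    have h1 : n⁻¹ ≤ 1 := inv_le_one_of_one_le₀ hn1
    have h2 : 0 ≤ n⁻¹ := by positivity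
    nlinarith
  have hp1 : c / n ≤ 1 / 2 := by rw [div_le_iff₀ hpos]; linarith
  have hp0 : 0 ≤ c / n := by positivity
  have key : ∀ y : V → Bool, y ∉ {y | particles y ∈ A} → 0 < φ (particles y) / (2 * M) →
      (1 + r) * (φ (particles y) / (2 * M)) ≤
        ∑ z, kcipKernel G (c / n) y z * (φ (particles z) / (2 * M)) := by
    intro y hy hφy
    have hφpos : 0 < φ (particles y) := by
      by_contra h
      exact absurd hφy (not_lt.2 (div_nonpos_of_nonpos_of_nonneg (not_lt.1 h) (by positivity)))
    have hsum : ∑ z, kcipKernel G (c / n) y z * (φ (particles z) / (2 * M)) =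
        (∑ z, kcipKernel G (c / n) y z * φ (particles z)) / (2 * M) := by
      rw [Finset.sum_div]
      exact Finset.sum_congr rfl fun z _ => by ring
    rw [hsum, ← mul_div_assoc]
    refine div_le_div_of_nonneg_right ?_ (by positivity)
    rw [sum_kcipKernel_particles]
    set X := particles y with hX
    have hXJ : X.card ≤ J := by
      by_contra h
      push Not at h
      rw [hφ] at hφpos
      simp [corrected, h] at hφpos
    suffices r * φ X ≤ n⁻¹ * (c / n * ∑ v ∈ boundarySet G X, (φ (insert v X) - φ X) +
        (1 - c / n) * ∑ v ∈ activeSet G X, (φ (X.erase v) - φ X)) by linarith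
    by_cases hst : activeSet G X = ∅
    · have hφf : φ X = f X := by rw [hφ, corrected, if_neg (by omega), if_pos hst]
      rw [hφf] at hφpos ⊢
      obtain ⟨hlt, hdr⟩ := hdrift X hst hy hφpos
      rw [hst, Finset.sum_empty, mul_zero, add_zero]
      have hterm : ∑ v ∈ boundarySet G X, (n * (deathAvg G f (insert v X) - f X) -
          C * J * deathAvg G f (insert v X) +
          if HasGoodBirth G f J Θ (insert v X) then b * deathAvg G f (insert v X) else 0) ≤
          n * ∑ v ∈ boundarySet G X, (φ (insert v X) - f X) := by
        rw [Finset.mul_sum]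
        refine Finset.sum_le_sum fun v hv => ?_
        have hv' := (Finset.mem_filter.1 hv).2
        have hcard : (insert v X).card = X.card + 1 := Finset.card_insert_of_notMem hv'.1
        have hact : activeSet G (insert v X) ≠ ∅ := by
          obtain ⟨u, hu, huv⟩ := hv'.2
          refine Finset.ne_empty_of_mem (a := v) ?_
          simp only [activeSet, Finset.mem_filter, Finset.mem_insert, true_or, true_and]
          exact ⟨u, Or.inr hu, huv⟩
        have hCJ : C * ((insert v X).card : ℝ) ≤ C * J := by
          gcongr; rw [hcard]; exact_mod_cast hlt
        have hd0 := deathAvg_nonneg (G := G) hf (insert v X)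
        have e : n * (φ (insert v X) - f X) = n * (deathAvg G f (insert v X) - f X) -
            C * (insert v X).card * deathAvg G f (insert v X) +
            if HasGoodBirth G f J Θ (insert v X) then b * deathAvg G f (insert v X) else 0 := by
          rw [hφ, corrected, if_neg (by omega), if_neg hact]
          split_ifs
          · field_simp; ring
          · field_simp; ring
        rw [e]
        have := mul_le_mul_of_nonneg_right hCJ hd0
        linarith
      have h1 : f X ≤ n * ∑ v ∈ boundarySet G X, (φ (insert v X) - f X) := hdr.trans hterm
      have e1 : r * (n * ∑ v ∈ boundarySet G X, (φ (insert v X) - f X)) =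
          n⁻¹ * (c / n * ∑ v ∈ boundarySet G X, (φ (insert v X) - f X)) := by
        rw [hr]; field_simp
      rw [← e1]
      gcongr
    · have h1 := corrected_step_of_unstable hf hc hD hC hb hbΘ hn hcn hbn hst hXJ
      rw [← hφ, ← hndef] at h1
      have h2 := mul_le_mul_of_nonneg_left h1 (by positivity : 0 ≤ n⁻¹)
      refine le_trans ?_ h2
      have h3 := hle X
      have h4 := deathAvg_nonneg (G := G) hf X
      nlinarith
  have hmain := trajProb_hit_ge (K := kcipKernel G (c / n))
    (kcipKernel_nonneg G hp0 (by linarith)) (sum_kcipKernel G _) {y | particles y ∈ A}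
    (fun y => φ (particles y) / (2 * M)) r hr0 (fun y => by
      rw [div_le_one (by positivity)]
      have := hle (particles y)
      have := deathAvg_le (G := G) hfM (particles y)
      linarith) key x T
  refine le_trans ?_ hmain
  have hφx : φ (particles x) = f (particles x) := by
    rw [hφ, corrected, if_neg (by omega), if_pos hx]
  simp only [hφx]
  have hB : 1 + (T : ℝ) * r ≤ (1 + r) ^ T := one_add_mul_le_pow (by linarith) T
  have : (1 + r) / (1 + r) ^ T ≤ 2 / (1 + T * r) := by
    gcongr
    linarith
  linarith

end Corrected

/-- One step of the lazy random walk with increments uniform in `E`. -/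
def lazyAvg {V : Type*} [AddCommGroup V] (E : Finset V) (g : V → ℝ) (x : V) : ℝ :=
  g x / 2 + (∑ e ∈ E, g (x + e)) / (2 * E.card)

/-- The law after `t` steps of the lazy random walk started at `0`. -/
def heat {V : Type*} [AddCommGroup V] (E : Finset V) : ℕ → V → ℝ
  | 0 => fun x => if x = 0 then 1 else 0
  | t + 1 => lazyAvg E (heat E t)

section Heat

variable {V : Type*} [AddCommGroup V] {E : Finset V}

lemma heat_zero (x : V) : heat E 0 x = if x = 0 then 1 else 0 := rfl

lemma heat_succ (t : ℕ) (x : V) : heat E (t + 1) x = lazyAvg E (heat E t) x := rfl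

lemma heat_nonneg (t : ℕ) (x : V) : 0 ≤ heat E t x := by
  induction t generalizing x with
  | zero => rw [heat_zero]; split_ifs <;> norm_num
  | succ t ih =>
    rw [heat_succ, lazyAvg]
    have := ih x
    have := Finset.sum_nonneg fun e (_ : e ∈ E) => ih (x + e)
    positivity

lemma half_heat_le (t : ℕ) (x : V) : heat E t x / 2 ≤ heat E (t + 1) x := by
  rw [heat_succ, lazyAvg]
  have := Finset.sum_nonneg fun e (_ : e ∈ E) => heat_nonneg (E := E) t (x + e)
  have : 0 ≤ (∑ e ∈ E, heat E t (x + e)) / (2 * E.card) := by positivity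
  linarith

lemma heat_step_le (t : ℕ) (x : V) {e : V} (he : e ∈ E) :
    heat E t (x + e) / (2 * E.card) ≤ heat E (t + 1) x := by
  rw [heat_succ, lazyAvg]
  have h1 : heat E t (x + e) ≤ ∑ e ∈ E, heat E t (x + e) :=
    Finset.single_le_sum (f := fun e => heat E t (x + e)) (fun e _ => heat_nonneg t _) he
  have h2 := heat_nonneg (E := E) t x
  have : heat E t (x + e) / (2 * E.card) ≤ (∑ e ∈ E, heat E t (x + e)) / (2 * E.card) := by
    gcongr
  linarith

lemma heat_eq_zero_of_le {R t : ℕ} (h : t ≤ R) {x : V} (hx : heat E R x = 0) :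
    heat E t x = 0 := by
  induction R, h using Nat.le_induction with
  | base => exact hx
  | succ R _ ih =>
    apply ih
    have h1 := half_heat_le (E := E) R x
    have h2 := heat_nonneg (E := E) R x
    linarith

lemma heat_add_eq_zero {R : ℕ} {x e : V} (he : e ∈ E) (hx : heat E (R + 1) x = 0) :
    heat E R (x + e) = 0 := by
  have h1 := heat_step_le (E := E) R x he
  have h2 := heat_nonneg (E := E) R (x + e)
  have h3 : (0 : ℝ) < E.card := by exact_mod_cast Finset.card_pos.2 ⟨e, he⟩
  rw [hx, div_le_iff₀ (by positivity)] at h1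
  linarith

lemma heat_eq_zero_or_ge (hE : E.Nonempty) (t : ℕ) (x : V) :
    heat E t x = 0 ∨ (1 / (2 * E.card : ℝ)) ^ t ≤ heat E t x := by
  have h3 : (1 : ℝ) ≤ E.card := by exact_mod_cast Finset.card_pos.2 hE
  induction t generalizing x with
  | zero => rw [heat_zero]; split_ifs <;> simp
  | succ t ih =>
    by_cases h0 : heat E t x = 0
    · by_cases h1 : ∃ e ∈ E, heat E t (x + e) ≠ 0
      · obtain ⟨e, he, hne⟩ := h1
        right
        refine le_trans ?_ (heat_step_le t x he)
        rw [pow_succ, mul_one_div]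
        gcongr
        exact (ih (x + e)).resolve_left hne
      · push Not at h1
        left
        rw [heat_succ, lazyAvg, h0, Finset.sum_eq_zero h1]
        simp
    · right
      refine le_trans ?_ (half_heat_le t x)
      have h4 := (ih x).resolve_left h0
      have h5 : 0 ≤ heat E t x := heat_nonneg t x
      rw [pow_succ, mul_one_div]
      gcongr
      linarith

lemma heat_neg (hE : ∀ e ∈ E, -e ∈ E) (t : ℕ) (x : V) : heat E t (-x) = heat E t x := by
  induction t generalizing x with
  | zero => simp [heat_zero]
  | succ t ih =>
    simp only [heat_succ, lazyAvg, ih]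
    congr 2
    refine Finset.sum_bij' (fun e _ => -e) (fun e _ => -e) hE hE (by simp) (by simp) ?_
    intro e _
    rw [← ih (-x + e)]
    congr 1
    abel

lemma heat_succ_add_pos (hE : ∀ e ∈ E, -e ∈ E) {t : ℕ} {x e : V} (he : e ∈ E)
    (hx : 0 < heat E t x) : 0 < heat E (t + 1) (x + e) := by
  refine lt_of_lt_of_le ?_ (heat_step_le t (x + e) (hE e he))
  have h3 : (0 : ℝ) < E.card := by exact_mod_cast Finset.card_pos.2 ⟨e, he⟩
  rw [add_neg_cancel_right]
  positivity

lemma heat_pos_of_le {R t : ℕ} (h : t ≤ R) {x : V} (hx : 0 < heat E t x) : 0 < heat E R x :=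
  (heat_nonneg R x).lt_of_ne fun h' => hx.ne' (heat_eq_zero_of_le h h'.symm)

lemma heat_one_pos (hE : ∀ e ∈ E, -e ∈ E) {e : V} (he : e ∈ E) : 0 < heat E 1 e := by
  have := heat_succ_add_pos hE he (t := 0) (x := 0) (by simp [heat_zero])
  simpa using this

lemma heat_two_pos (hE : ∀ e ∈ E, -e ∈ E) {e e' : V} (he : e ∈ E) (he' : e' ∈ E) :
    0 < heat E 2 (e + e') :=
  heat_succ_add_pos hE he' (heat_one_pos hE he)

lemma heat_three_pos (hE : ∀ e ∈ E, -e ∈ E) {e e' e'' : V} (he : e ∈ E) (he' : e' ∈ E)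
    (he'' : e'' ∈ E) : 0 < heat E 3 (e + e' + e'') :=
  heat_succ_add_pos hE he'' (heat_two_pos hE he he')

lemma lazyAvg_mono {g h : V → ℝ} (hgh : ∀ x, g x ≤ h x) (x : V) :
    lazyAvg E g x ≤ lazyAvg E h x := by
  unfold lazyAvg
  gcongr
  · exact hgh x
  · exact hgh _

lemma lazyAvg_const (hE : E.Nonempty) (a : ℝ) (x : V) : lazyAvg E (fun _ => a) x = a := by
  have h3 : (E.card : ℝ) ≠ 0 := by exact_mod_cast (Finset.card_pos.2 hE).ne'
  simp only [lazyAvg, Finset.sum_const, nsmul_eq_mul]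
  field_simp
  ring

lemma lazyAvg_add (g h : V → ℝ) (x : V) :
    lazyAvg E (fun y => g y + h y) x = lazyAvg E g x + lazyAvg E h x := by
  simp only [lazyAvg, Finset.sum_add_distrib]
  ring

lemma lazyAvg_mul (a : ℝ) (g : V → ℝ) (x : V) :
    lazyAvg E (fun y => a * g y) x = a * lazyAvg E g x := by
  simp only [lazyAvg, ← Finset.mul_sum]
  ring

lemma lazyAvg_sum {ι : Type*} (s : Finset ι) (g : ι → V → ℝ) (x : V) :
    lazyAvg E (fun y => ∑ i ∈ s, g i y) x = ∑ i ∈ s, lazyAvg E (g i) x := by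
  simp only [lazyAvg, Finset.sum_add_distrib, Finset.sum_div]
  rw [Finset.sum_comm]

lemma sum_sub_eq_lazyAvg (hE : E.Nonempty) (g : V → ℝ) (x : V) :
    ∑ e ∈ E, (g (x + e) - g x) = 2 * E.card * (lazyAvg E g x - g x) := by
  have h3 : (E.card : ℝ) ≠ 0 := by exact_mod_cast (Finset.card_pos.2 hE).ne'
  rw [lazyAvg, Finset.sum_sub_distrib, Finset.sum_const, nsmul_eq_mul]
  field_simp
  ring

lemma sum_heat_sub_lazyAvg (R : ℕ) (x : V) :
    ∑ t ∈ Finset.range R, heat E t x -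
      lazyAvg E (fun y => ∑ t ∈ Finset.range R, heat E t y) x = heat E 0 x - heat E R x := by
  rw [lazyAvg_sum, ← Finset.sum_sub_distrib]
  simp only [← heat_succ]
  rw [Finset.sum_range_sub']

/-- `r` is a Green function of the lazy walk on a finite group. -/
structure IsGreen [Fintype V] (E : Finset V) (r : V → ℝ) : Prop where
  neg : ∀ x, r (-x) = r x
  eq : ∀ x, r x - lazyAvg E r x = heat E 0 x - 1 / Fintype.card V

variable [Fintype V] {r : V → ℝ}

lemma IsGreen.iterate_sub (hE : E.Nonempty) (hr : IsGreen E r) (t : ℕ) (x : V) :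
    (lazyAvg E)^[t] r x - (lazyAvg E)^[t + 1] r x = heat E t x - 1 / Fintype.card V := by
  induction t generalizing x with
  | zero => simpa using hr.eq x
  | succ t ih =>
    have h : heat E t = fun y => (lazyAvg E)^[t] r y + ((-1) * (lazyAvg E)^[t + 1] r y +
        1 / Fintype.card V) := by
      funext y
      have := ih y
      linarith
    rw [heat_succ, h, lazyAvg_add, lazyAvg_add, lazyAvg_mul, lazyAvg_const hE]
    simp only [Function.iterate_succ_apply']
    ring

lemma IsGreen.sum_heat (hE : E.Nonempty) (hr : IsGreen E r) (R : ℕ) (x : V) :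
    ∑ t ∈ Finset.range R, heat E t x = r x - (lazyAvg E)^[R] r x + R / Fintype.card V := by
  induction R with
  | zero => simp
  | succ R ih =>
    rw [Finset.sum_range_succ, ih]
    have := hr.iterate_sub hE R x
    push_cast
    rw [add_div]
    linarith

lemma IsGreen.iterate_neg (hE : E.Nonempty) (hEn : ∀ e ∈ E, -e ∈ E) (hr : IsGreen E r) (R : ℕ)
    (x : V) : (lazyAvg E)^[R] r (-x) = (lazyAvg E)^[R] r x := by
  have h1 := hr.sum_heat hE R x
  have h2 := hr.sum_heat hE R (-x)
  simp only [heat_neg hEn, hr.neg] at h2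
  linarith

end Heat

section Potentials

variable {V : Type*} [AddCommGroup V] [Fintype V] {E : Finset V} {r : V → ℝ} {C₀ ε : ℝ} {R : ℕ}

lemma IsGreen.exists_annihilation_potential (hE : E.Nonempty) (hEn : ∀ e ∈ E, -e ∈ E)
    (hr : IsGreen E r) (hC₀ : ∀ x, |r x| ≤ C₀) (hR : ∀ x, |(lazyAvg E)^[R + 1] r x| ≤ ε)
    (hn : R + 1 ≤ Fintype.card V) :
    ∃ h : V → ℝ, (∀ x, h (-x) = h x) ∧ (∀ x, ε ≤ h x) ∧ (∀ x, h x ≤ 2 * C₀ + 3 * ε + 2) ∧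
      (∀ x, x ≠ 0 → lazyAvg E h x - h x = heat E (R + 1) x + 1 / Fintype.card V) ∧
      ∀ x, heat E (R + 1) x = 0 → h x ≤ 3 * ε ∧ ∀ e ∈ E, h (x + e) ≤ 3 * ε := by
  set n : ℝ := (Fintype.card V : ℝ) with hndef
  have hn' : ((R + 1 : ℕ) : ℝ) ≤ n := by rw [hndef]; exact_mod_cast hn
  have hn0 : 0 < n := lt_of_lt_of_le (by positivity) hn'
  refine ⟨fun x => 2 * ∑ t ∈ range (R + 1), heat E t x +
    ((lazyAvg E)^[R + 1] r x + 2 * ε), fun x => ?_, fun x => ?_, fun x => ?_, fun x hx => ?_,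
    fun x hx => ⟨?_, fun e he => ?_⟩⟩
  · simp only [heat_neg hEn, hr.iterate_neg hE hEn]
  · have h1 : 0 ≤ ∑ t ∈ range (R + 1), heat E t x := sum_nonneg fun t _ => heat_nonneg t x
    have := abs_le.1 (hR x)
    linarith
  · have h1 := hr.sum_heat hE (R + 1) x
    have h2 : ((R + 1 : ℕ) : ℝ) / n ≤ 1 := by rwa [div_le_one hn0]
    have h3 := abs_le.1 (hR x)
    have h4 := abs_le.1 (hC₀ x)
    rw [← hndef] at h1
    linarith
  · rw [lazyAvg_add, lazyAvg_mul, lazyAvg_add, lazyAvg_const hE]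
    have h1 := sum_heat_sub_lazyAvg (E := E) (R + 1) x
    have h2 := hr.iterate_sub hE (R + 1) x
    rw [Function.iterate_succ_apply' _ (R + 1), ← hndef] at h2
    rw [heat_zero, if_neg hx] at h1
    dsimp only
    linarith
  · have h1 : ∑ t ∈ range (R + 1), heat E t x = 0 :=
      sum_eq_zero fun t ht => heat_eq_zero_of_le (mem_range.1 ht).le hx
    have := abs_le.1 (hR x)
    simp only [h1]
    linarith
  · have h1 : ∑ t ∈ range (R + 1), heat E t (x + e) = 0 :=
      sum_eq_zero fun t ht => heat_eq_zero_of_le (Nat.lt_succ_iff.1 (mem_range.1 ht))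
        (heat_add_eq_zero he hx)
    have := abs_le.1 (hR (x + e))
    simp only [h1]
    linarith

lemma IsGreen.exists_superharmonic (hE : E.Nonempty) (hEn : ∀ e ∈ E, -e ∈ E) (h0 : 0 ∉ E)
    (hr : IsGreen E r) (hC₀ : ∀ x, |r x| ≤ C₀) (hε : ε ≤ 1)
    (hR : ∀ s, R + 1 ≤ s → ∀ x, |(lazyAvg E)^[s] r x| ≤ ε)
    (hn : R + 2 ≤ Fintype.card V) (hnD : 4 + 4 * (E.card : ℝ) ≤ Fintype.card V)
    (hnε : 1 ≤ ε * Fintype.card V) :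
    ∃ h : V → ℝ, (∀ x, h (-x) = h x) ∧ (∀ x, 0 ≤ h x) ∧ (∀ x, h x ≤ C₀ + 4) ∧
      (∀ e ∈ E, 1 / (2 * E.card) ≤ h e) ∧
      (∀ x, x ≠ 0 → h x - lazyAvg E h x = heat E (R + 2) x - 2 / Fintype.card V) ∧
      (∀ x, heat E (R + 2) x = 0 → h x ≤ 7 * ε ∧ ∀ e ∈ E, h (x + e) ≤ 7 * ε ∧
        ∀ e' ∈ E, h (x + e + e') ≤ 7 * ε) ∧
      ∃ e₀ ∈ E, (∀ e ∈ E, h e₀ ≤ h e) ∧ ∃ e₁ ∈ E, e₀ + e₁ ≠ 0 ∧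
        h (e₀ + e₁) ≤ h e₀ - 1 / E.card := by
  set n : ℝ := (Fintype.card V : ℝ) with hndef
  have hn' : ((R + 2 : ℕ) : ℝ) ≤ n := by rw [hndef]; exact_mod_cast hn
  have hn0 : 0 < n := lt_of_lt_of_le (by positivity) hn'
  have hD : (1 : ℝ) ≤ E.card := by exact_mod_cast Finset.card_pos.2 hE
  have hε1 : 1 / n ≤ ε := by rwa [div_le_iff₀ hn0]
  set h : V → ℝ := fun x => ∑ t ∈ range (R + 2), heat E t x +
    (2 * (lazyAvg E)^[R + 2] r x + 2 * ε) with hh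
  have hsum0 : ∀ x, 0 ≤ ∑ t ∈ range (R + 2), heat E t x :=
    fun x => sum_nonneg fun t _ => heat_nonneg t x
  have hge : ∀ x, ∑ t ∈ range (R + 2), heat E t x ≤ h x := by
    intro x
    have := abs_le.1 (hR (R + 2) (by omega) x)
    simp only [hh]
    linarith
  have hle : ∀ x, h x ≤ ∑ t ∈ range (R + 2), heat E t x + 4 * ε := by
    intro x
    have := abs_le.1 (hR (R + 2) (by omega) x)
    simp only [hh]
    linarith
  have hdiff : ∀ x, h x - lazyAvg E h x = heat E 0 x + heat E (R + 2) x - 2 / n := by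
    intro x
    simp only [hh]
    rw [lazyAvg_add, lazyAvg_add, lazyAvg_mul, lazyAvg_const hE]
    have h1 := sum_heat_sub_lazyAvg (E := E) (R + 2) x
    have h2 := hr.iterate_sub hE (R + 2) x
    rw [Function.iterate_succ_apply' _ (R + 2), ← hndef] at h2
    have h3 : 2 / n = 2 * (1 / n) := by ring
    linarith
  refine ⟨h, fun x => ?_, fun x => (hsum0 x).trans (hge x), fun x => ?_, fun e he => ?_,
    fun x hx => ?_, fun x hx => ?_, ?_⟩
  · simp only [hh, heat_neg hEn, hr.iterate_neg hE hEn]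
  · have h1 := hr.sum_heat hE (R + 2) x
    have h2 : ((R + 2 : ℕ) : ℝ) / n ≤ 1 := by rwa [div_le_one hn0]
    have h3 := abs_le.1 (hR (R + 2) (by omega) x)
    have h4 := abs_le.1 (hC₀ x)
    rw [← hndef] at h1
    simp only [hh]
    linarith
  · refine le_trans ?_ (hge e)
    refine le_trans ?_ (single_le_sum (f := fun t => heat E t e) (fun t _ => heat_nonneg t e)
      (mem_range.2 (by omega : 1 < R + 2)))
    have := heat_step_le (E := E) 0 e (hEn e he)
    simpa [heat_zero] using this
  · rw [hdiff, heat_zero, if_neg hx]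
    ring
  · have hz : ∀ e ∈ E, heat E (R + 1) (x + e) = 0 := fun e he => heat_add_eq_zero he hx
    have hε0 : 0 ≤ ε := le_trans (by positivity) hε1
    refine ⟨?_, fun e he => ⟨?_, fun e' he' => ?_⟩⟩
    · have h1 : ∑ t ∈ range (R + 2), heat E t x = 0 :=
        sum_eq_zero fun t ht => heat_eq_zero_of_le (mem_range.1 ht).le hx
      have := hle x
      linarith
    · have h1 : ∑ t ∈ range (R + 2), heat E t (x + e) = 0 :=
        sum_eq_zero fun t ht => heat_eq_zero_of_le (Nat.lt_succ_iff.1 (mem_range.1 ht)) (hz e he)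
      have := hle (x + e)
      linarith
    · have h1 : ∑ t ∈ range (R + 1), heat E t (x + e + e') = 0 :=
        sum_eq_zero fun t ht => heat_eq_zero_of_le (Nat.lt_succ_iff.1 (mem_range.1 ht))
          (heat_add_eq_zero he' (hz e he))
      have h2 := hle (x + e + e')
      rw [sum_range_succ, h1] at h2
      have h3 := hr.iterate_sub hE (R + 1) (x + e + e')
      rw [← hndef] at h3
      have h4 := abs_le.1 (hR (R + 1) le_rfl (x + e + e'))
      have h5 := abs_le.1 (hR (R + 1 + 1) (by omega) (x + e + e'))
      linarith
  · obtain ⟨e₀, he₀, hmin⟩ := exists_min_image E h hE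
    refine ⟨e₀, he₀, hmin, ?_⟩
    have hne : e₀ ≠ 0 := fun h => h0 (h ▸ he₀)
    have a1 := hdiff e₀
    have a2 := hdiff 0
    have a3 := heat_nonneg (E := E) (R + 2) e₀
    have a4 := heat_nonneg (E := E) (R + 2) 0
    rw [heat_zero, if_neg hne] at a1
    rw [heat_zero, if_pos rfl] at a2
    rw [lazyAvg] at a1 a2
    simp only [zero_add] at a2
    have b1 : E.card * h e₀ ≤ ∑ e ∈ E, h e := by
      rw [← nsmul_eq_mul]
      exact card_nsmul_le_sum _ _ _ hmin
    have b2 : h e₀ / 2 ≤ (∑ e ∈ E, h e) / (2 * E.card) := by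
      rw [le_div_iff₀ (by positivity)]
      linarith
    have b3 : h e₀ + 2 - 4 / n ≤ h 0 := by
      have : 4 / n = 2 * (2 / n) := by ring
      linarith
    have b4 : ∑ e ∈ E, h (e₀ + e) ≤ E.card * h e₀ + 4 * E.card / n := by
      have : (∑ e ∈ E, h (e₀ + e)) / (2 * E.card) ≤ h e₀ / 2 + 2 / n := by linarith
      rw [div_le_iff₀ (by positivity)] at this
      have e1 : (h e₀ / 2 + 2 / n) * (2 * E.card) = E.card * h e₀ + 4 * E.card / n := by ring
      linarith
    rw [← add_sum_erase E _ (hEn e₀ he₀), add_neg_cancel] at b4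
    by_contra hcon
    push Not at hcon
    have b5 : ((E.erase (-e₀)).card : ℝ) * (h e₀ - 1 / E.card) ≤
        ∑ e ∈ E.erase (-e₀), h (e₀ + e) := by
      rw [← nsmul_eq_mul]
      refine card_nsmul_le_sum _ _ _ fun e he => ?_
      rw [mem_erase] at he
      exact (hcon e he.2 fun h' => he.1 (by rw [eq_neg_iff_add_eq_zero, add_comm]; exact h')).le
    rw [card_erase_of_mem (hEn e₀ he₀), Nat.cast_sub (card_pos.2 hE), Nat.cast_one] at b5
    have b6 : 4 / n + 4 * E.card / n ≤ 1 := by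
      rw [← add_div, div_le_one hn0]
      exact hnD
    have b7 : ((E.card : ℝ) - 1) * (h e₀ - 1 / E.card) =
        E.card * h e₀ - h e₀ - 1 + 1 / E.card := by
      field_simp
      ring
    have b8 : (0 : ℝ) < 1 / E.card := by positivity
    linarith

lemma IsGreen.exists_creation_potential (hE : E.Nonempty) (hEn : ∀ e ∈ E, -e ∈ E) (h0 : 0 ∉ E)
    (hr : IsGreen E r) (hC₀ : ∀ x, |r x| ≤ C₀) (hε : ε ≤ 1)
    (hR : ∀ s, R + 1 ≤ s → ∀ x, |(lazyAvg E)^[s] r x| ≤ ε)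
    (hn : R + 2 ≤ Fintype.card V) (hnD : 4 + 4 * (E.card : ℝ) ≤ Fintype.card V)
    (hnε : 1 ≤ ε * Fintype.card V) {κ : ℝ}
    (hκ : κ * (8 * E.card * (C₀ + 4) ^ 2) = (1 / (2 * E.card : ℝ)) ^ (R + 2))
    (hnκ : 32 * E.card * (C₀ + 4) ≤ (1 / (2 * E.card : ℝ)) ^ (R + 2) * Fintype.card V) :
    ∃ H : V → ℝ, (∀ x, H (-x) = H x) ∧ (∀ x, 0 ≤ H x) ∧
      (∀ x, H x ≤ 3 * E.card * (C₀ + 5)) ∧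
      (∀ e ∈ E, ∀ x, 2 ≤ 3 * H e - H x) ∧
      (∀ x, x ≠ 0 → -(16 * E.card) / Fintype.card V ≤ H x - lazyAvg E H x) ∧
      (∀ x, x ≠ 0 → 0 < heat E (R + 2) x → κ ≤ H x - lazyAvg E H x) ∧
      (∀ x, heat E (R + 2) x = 0 → H x ≤ 38 * E.card * ε ∧
        ∀ e ∈ E, H (x + e) ≤ 38 * E.card * ε ∧ ∀ e' ∈ E, H (x + e + e') ≤ 38 * E.card * ε) ∧
      ∃ e₀ ∈ E, ∃ e₁ ∈ E, e₀ + e₁ ≠ 0 ∧ e₀ + e₁ ∉ E ∧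
        H (e₀ + e₁) ≤ 1 - 1 / (2 * E.card * (C₀ + 4)) := by
  obtain ⟨h, heven, hnn, hle, hlow, hdiff, hfar, e₀, he₀, hmin, e₁, he₁, hne, hgap⟩ :=
    hr.exists_superharmonic hE hEn h0 hC₀ hε hR hn hnD hnε
  have hD : (1 : ℝ) ≤ E.card := by exact_mod_cast Finset.card_pos.2 hE
  have hC : 0 ≤ C₀ := (abs_nonneg _).trans (hC₀ 0)
  set n : ℝ := (Fintype.card V : ℝ) with hndef
  set D : ℝ := (E.card : ℝ) with hDdef
  set K : ℝ := C₀ + 4 with hK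
  have hK4 : 4 ≤ K := by linarith
  have hn0 : 0 < n := by linarith
  set q : ℝ := (1 / (2 * D)) ^ (R + 2) with hq
  have hq0 : 0 < q := by positivity
  set τ := h e₀ with hτ
  have hτ1 : 1 / (2 * D) ≤ τ := hlow e₀ he₀
  have hτK : τ ≤ K := hle e₀
  set β : ℝ := 1 / (4 * D * K) with hβ
  have hβ0 : 0 < β := by positivity
  have hβK : β * K = 1 / (4 * D) := by rw [hβ]; field_simp
  have hβ1 : β ≤ 1 := by
    rw [hβ, div_le_one (by positivity)]
    nlinarith
  set t : ℝ := τ - β * K / 2 with ht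
  have hDinv : 0 < 1 / D := by positivity
  have u1 : 1 / (2 * D) = 1 / D / 2 := by field_simp
  have u2 : 1 / (4 * D) = 1 / D / 4 := by field_simp
  have ht1 : 3 / 8 * (1 / D) ≤ t := by
    rw [ht, hβK]
    linarith
  have ht0 : 0 < t := by linarith
  have htK : t ≤ K := by linarith [mul_pos hβ0 (by linarith : 0 < K)]
  have htinv : 1 / t ≤ 8 / 3 * D := by
    rw [div_le_iff₀ ht0]
    have := mul_le_mul_of_nonneg_left ht1 (by positivity : 0 ≤ 8 / 3 * D)
    have e : 8 / 3 * D * (3 / 8 * (1 / D)) = 1 := by field_simp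
    linarith
  set H₀ : V → ℝ := fun x => min (h x) τ + β * h x with hH₀
  have hH0 : ∀ x, 0 ≤ H₀ x := by
    intro x
    have h1 := hnn x
    have h2 : 0 ≤ min (h x) τ := le_min h1 (by linarith)
    simp only [hH₀]
    positivity
  have hH0e : ∀ e ∈ E, τ ≤ H₀ e := by
    intro e he
    simp only [hH₀]
    rw [min_eq_right (hmin e he)]
    have := mul_nonneg hβ0.le (hnn e)
    linarith
  have hβh : ∀ x, β * h x ≤ β * K := fun x => mul_le_mul_of_nonneg_left (hle x) hβ0.le
  have hH0le : ∀ x, H₀ x ≤ τ + β * K := by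
    intro x
    have h1 := hβh x
    have h2 := min_le_right (h x) τ
    simp only [hH₀]
    linarith
  have hdiff0 : ∀ x, x ≠ 0 → β * heat E (R + 2) x - 4 / n ≤ H₀ x - lazyAvg E H₀ x := by
    intro x hx
    simp only [hH₀]
    rw [lazyAvg_add, lazyAvg_mul]
    have h1 := hdiff x hx
    have h2 : lazyAvg E (fun y => min (h y) τ) x ≤ lazyAvg E h x :=
      lazyAvg_mono (fun y => min_le_left _ _) x
    have h3 : lazyAvg E (fun y => min (h y) τ) x ≤ lazyAvg E (fun _ => τ) x :=
      lazyAvg_mono (fun y => min_le_right _ _) x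
    rw [lazyAvg_const hE] at h3
    have h4 : -(2 / n) ≤ min (h x) τ - lazyAvg E (fun y => min (h y) τ) x := by
      have h5 : 0 < 2 / n := by positivity
      have h6 := heat_nonneg (E := E) (R + 2) x
      rcases min_choice (h x) τ with h' | h' <;> rw [h'] <;> linarith
    have h5 : β * (h x - lazyAvg E h x) = β * heat E (R + 2) x - β * (2 / n) := by
      rw [h1]; ring
    have h6 : β * (2 / n) ≤ 1 * (2 / n) := by gcongr
    have h7 : 4 / n = 2 * (2 / n) := by ring
    linarith
  have hfac : ∀ a, 0 ≤ a → a / t ≤ a * (8 / 3 * D) := by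
    intro a ha
    rw [div_eq_mul_one_div]
    gcongr
  have hlazy : ∀ x, lazyAvg E (fun y => H₀ y / t) x = lazyAvg E H₀ x / t := by
    intro x
    have : (fun y => H₀ y / t) = fun y => t⁻¹ * H₀ y := by
      funext y; rw [div_eq_inv_mul]
    rw [this, lazyAvg_mul, div_eq_inv_mul]
  have hfar0 : ∀ x, h x ≤ 7 * ε → H₀ x / t ≤ 38 * D * ε := by
    intro x hx
    have h1 := hnn x
    have h2 : H₀ x ≤ 14 * ε := by
      have h3 := min_le_left (h x) τ
      have h4 := mul_le_mul_of_nonneg_right hβ1 h1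
      simp only [hH₀]
      linarith
    have h3 := hfac (H₀ x) (hH0 x)
    have h4 : H₀ x * (8 / 3 * D) ≤ 14 * ε * (8 / 3 * D) := by gcongr
    have h5 : 0 ≤ D * ε := mul_nonneg (by linarith) (by linarith)
    linarith
  have hKD : β * K ≤ 1 := by
    rw [hβK, div_le_one (by positivity)]
    linarith
  refine ⟨fun x => H₀ x / t, fun x => ?_, fun x => div_nonneg (hH0 x) ht0.le, fun x => ?_,
    fun e he x => ?_, fun x hx => ?_, fun x hx hx' => ?_, fun x hx => ?_, e₀, he₀, e₁, he₁, hne,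
    fun hmem => ?_, ?_⟩
  · simp only [hH₀, heven]
  · have h1 := hfac _ (hH0 x)
    have h2 : H₀ x * (8 / 3 * D) ≤ (C₀ + 5) * (8 / 3 * D) := by
      gcongr
      linarith [hH0le x]
    have h3 : 0 ≤ (C₀ + 5) * D := by positivity
    dsimp only
    linarith
  · dsimp only
    have h1 := hH0e e he
    have h2 := hH0le x
    rw [mul_div_assoc', ← sub_div, le_div_iff₀ ht0]
    linarith
  · rw [hlazy, ← sub_div]
    have h1 := hdiff0 x hx
    have h2 := mul_nonneg hβ0.le (heat_nonneg (E := E) (R + 2) x)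
    have h3 := hfac (4 / n) (by positivity)
    have h4 : -(4 / n) / t ≤ (H₀ x - lazyAvg E H₀ x) / t := by
      gcongr
      linarith
    have h5 : -(4 / n) / t = -(4 / n / t) := by ring
    have h6 : 4 / n * (8 / 3 * D) = 32 / 3 * (D / n) := by ring
    have h7 : -(16 * D) / n = -(16 * (D / n)) := by ring
    have h8 : 0 < D / n := by positivity
    linarith
  · rw [hlazy, ← sub_div]
    have h1 := hdiff0 x hx
    have h2 : q ≤ heat E (R + 2) x := (heat_eq_zero_or_ge hE _ x).resolve_left hx'.ne'
    have h3 := mul_le_mul_of_nonneg_left h2 hβ0.le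
    have h4 : 4 / n ≤ β * q / 2 := by
      rw [div_le_iff₀ hn0, hβ]
      have : 1 / (4 * D * K) * q / 2 * n = (q * n) / (8 * D * K) := by field_simp; ring
      rw [this, le_div_iff₀ (by positivity)]
      linarith
    have hκ0 : 0 ≤ κ := by
      by_contra hcon
      push Not at hcon
      have : κ * (8 * D * K ^ 2) < 0 := mul_neg_of_neg_of_pos hcon (by positivity)
      linarith
    rw [le_div_iff₀ ht0]
    have h5 : κ * t ≤ κ * K := by gcongr
    have h6 : κ * K = β * q / 2 := by
      rw [← hκ, hβ]; field_simp; ring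
    linarith
  · obtain ⟨g1, g2⟩ := hfar x hx
    exact ⟨hfar0 _ g1, fun e he => ⟨hfar0 _ (g2 e he).1, fun e' he' =>
      hfar0 _ ((g2 e he).2 e' he')⟩⟩
  · have := hmin _ hmem
    linarith
  · dsimp only
    have h1 : min (h (e₀ + e₁)) τ ≤ τ - 1 / D := (min_le_left _ _).trans hgap
    have h2 := hβh (e₀ + e₁)
    rw [div_le_iff₀ ht0]
    have h3 : 1 / (2 * D * K) * t ≤ 1 / (2 * D * K) * K := by gcongr
    have h4 : 1 / (2 * D * K) * K = 1 / D / 2 := by field_simp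
    have h5 : H₀ (e₀ + e₁) ≤ τ - 1 / D + β * K := by
      simp only [hH₀]
      linarith
    rw [hβK] at h5 ht
    rw [sub_mul]
    linarith

end Potentials

/-- The neighbours of `v` in `S`. -/
def nbrs {V : Type*} (G : SimpleGraph V) (S : Finset V) (v : V) : Finset V :=
  S.filter fun u => G.Adj u v

/-- The sum of `h (u - w)` over unordered pairs of points of `S`, for even `h`. -/
def pairEnergy {V : Type*} [AddCommGroup V] (h : V → ℝ) (S : Finset V) : ℝ :=
  (∑ u ∈ S, ∑ w ∈ S.erase u, h (u - w)) / 2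

section Stable

variable {V : Type*} {G : SimpleGraph V} {f : Finset V → ℝ} {S T : Finset V} {u v : V}

lemma mem_nbrs : u ∈ nbrs G S v ↔ u ∈ S ∧ G.Adj u v := mem_filter

lemma nbrs_erase (u : V) : nbrs G (S.erase u) v = (nbrs G S v).erase u := by
  ext w; simp [nbrs, and_assoc]

lemma activeSet_eq_empty_iff : activeSet G S = ∅ ↔ ∀ u ∈ S, ∀ v ∈ S, ¬ G.Adj u v := by
  simp only [activeSet, filter_eq_empty_iff, not_exists, not_and]
  exact ⟨fun h u hu v hv => h hv u hu, fun h v hv u hu => h u hu v hv⟩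

lemma activeSet_empty_mono (hS : activeSet G S = ∅) (hT : T ⊆ S) : activeSet G T = ∅ := by
  rw [activeSet_eq_empty_iff] at hS ⊢
  exact fun u hu v hv => hS u (hT hu) v (hT hv)

lemma activeSet_insert_of_nbrs_eq_empty (hS : activeSet G S = ∅) (hv : nbrs G S v = ∅) :
    activeSet G (insert v S) = ∅ := by
  rw [activeSet_eq_empty_iff] at hS ⊢
  have h : ∀ u ∈ S, ¬ G.Adj u v := fun u hu huv => by
    have := mem_nbrs.2 ⟨hu, huv⟩
    simp [hv] at this
  intro u hu w hw huw
  rw [mem_insert] at hu hw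
  rcases hu with rfl | hu <;> rcases hw with rfl | hw
  · exact G.loopless.irrefl _ huw
  · exact h _ hw huw.symm
  · exact h _ hu huw
  · exact hS _ hu _ hw huw

lemma activeSet_insert (hS : activeSet G S = ∅) (hv : nbrs G S v ≠ ∅) :
    activeSet G (insert v S) = insert v (nbrs G S v) := by
  rw [activeSet_eq_empty_iff] at hS
  ext w
  simp only [activeSet, mem_filter, mem_insert, mem_nbrs]
  constructor
  · rintro ⟨rfl | hw, u, rfl | hu, huw⟩
    · exact Or.inl rfl
    · exact Or.inl rfl
    · exact Or.inr ⟨hw, huw.symm⟩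
    · exact absurd huw (hS _ hu _ hw)
  · rintro (rfl | ⟨hw, hwv⟩)
    · obtain ⟨u, hu⟩ := nonempty_iff_ne_empty.2 hv
      rw [mem_nbrs] at hu
      exact ⟨Or.inl rfl, u, Or.inr hu.1, hu.2⟩
    · exact ⟨Or.inr hw, v, Or.inl rfl, hwv.symm⟩

lemma deathAvg_insert (hS : activeSet G S = ∅) (hvS : v ∉ S) (hv : nbrs G S v ≠ ∅) :
    ((nbrs G S v).card + 1 : ℝ) * deathAvg G f (insert v S) =
      f S + ∑ u ∈ nbrs G S v, deathAvg G f (insert v (S.erase u)) := by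
  have hvN : v ∉ nbrs G S v := fun h => hvS (mem_nbrs.1 h).1
  have hact := activeSet_insert hS hv
  have hne : activeSet G (insert v S) ≠ ∅ := by rw [hact]; exact insert_ne_empty _ _
  have h := card_mul_deathAvg (f := f) hne
  rw [hact, card_insert_of_notMem hvN, sum_insert hvN, erase_insert hvS,
    deathAvg_of_stable hS] at h
  push_cast at h
  rw [h]
  congr 1
  refine sum_congr rfl fun u hu => ?_
  rw [erase_insert_of_ne]
  rintro rfl
  exact hvN hu

lemma deathAvg_insert_of_nbrs_eq_empty (hS : activeSet G S = ∅) (hv : nbrs G S v = ∅) :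
    deathAvg G f (insert v S) = f (insert v S) :=
  deathAvg_of_stable (activeSet_insert_of_nbrs_eq_empty hS hv)

lemma deathAvg_insert_of_nbrs_eq_singleton (hS : activeSet G S = ∅) (hvS : v ∉ S)
    (hv : nbrs G S v = {u}) :
    deathAvg G f (insert v S) = (f S + f (insert v (S.erase u))) / 2 := by
  have h := deathAvg_insert (f := f) hS hvS (by rw [hv]; exact singleton_ne_empty u)
  rw [hv, sum_singleton, card_singleton, deathAvg_insert_of_nbrs_eq_empty
    (activeSet_empty_mono hS (erase_subset _ _)) (by rw [nbrs_erase, hv]; simp)] at h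
  push_cast at h
  linarith

lemma mem_boundarySet [Fintype V] : v ∈ boundarySet G S ↔ v ∉ S ∧ nbrs G S v ≠ ∅ := by
  simp [boundarySet, nbrs, filter_eq_empty_iff]

end Stable

section PairEnergy

variable {V : Type*} [AddCommGroup V] {h : V → ℝ} {S : Finset V} {M : ℝ}

lemma pairEnergy_insert (hh : ∀ x, h (-x) = h x) {v : V} (hv : v ∉ S) :
    pairEnergy h (insert v S) = pairEnergy h S + ∑ w ∈ S, h (v - w) := by
  unfold pairEnergy
  rw [sum_insert hv, erase_insert hv]
  have : ∑ u ∈ S, ∑ w ∈ (insert v S).erase u, h (u - w) =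
      ∑ u ∈ S, (h (v - u) + ∑ w ∈ S.erase u, h (u - w)) := by
    refine sum_congr rfl fun u hu => ?_
    rw [erase_insert_of_ne (by rintro rfl; exact hv hu),
      sum_insert (fun h' => hv (mem_of_mem_erase h')), ← hh (u - v), neg_sub]
  rw [this, sum_add_distrib]
  ring

lemma pairEnergy_erase (hh : ∀ x, h (-x) = h x) {v : V} (hv : v ∈ S) :
    pairEnergy h S = pairEnergy h (S.erase v) + ∑ w ∈ S.erase v, h (v - w) := by
  conv_lhs => rw [← insert_erase hv]
  exact pairEnergy_insert hh (notMem_erase _ _)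

lemma pairEnergy_nonneg (hh : ∀ x, 0 ≤ h x) : 0 ≤ pairEnergy h S :=
  div_nonneg (sum_nonneg fun _ _ => sum_nonneg fun _ _ => hh _) zero_le_two

lemma pairEnergy_le (hM : 0 ≤ M) (hh : ∀ u ∈ S, ∀ w ∈ S, u ≠ w → h (u - w) ≤ M) :
    pairEnergy h S ≤ (S.card : ℝ) ^ 2 * M / 2 := by
  unfold pairEnergy
  gcongr
  calc ∑ u ∈ S, ∑ w ∈ S.erase u, h (u - w) ≤ ∑ u ∈ S, (S.card : ℝ) * M := by
        refine sum_le_sum fun u hu => ?_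
        calc ∑ w ∈ S.erase u, h (u - w) ≤ (S.erase u).card • M :=
              sum_le_card_nsmul _ _ _ fun w hw => hh u hu w (mem_of_mem_erase hw)
                (ne_of_mem_erase hw).symm
          _ ≤ S.card * M := by
              rw [nsmul_eq_mul]
              gcongr
              exact erase_subset _ _
    _ = (S.card : ℝ) ^ 2 * M := by rw [sum_const, nsmul_eq_mul]; ring

variable [Fintype V] {E : Finset V} {G : SimpleGraph V}

lemma sum_boundarySet_nbrs (hG : ∀ u v, G.Adj u v ↔ v - u ∈ E) (hS : activeSet G S = ∅)
    (F : V → V → ℝ) :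
    ∑ v ∈ boundarySet G S, ∑ u ∈ nbrs G S v, F u v = ∑ u ∈ S, ∑ e ∈ E, F u (u + e) := by
  rw [activeSet_eq_empty_iff] at hS
  rw [sum_sigma', sum_sigma']
  refine sum_bij' (fun p _ => ⟨p.2, p.1 - p.2⟩) (fun p _ => ⟨p.1 + p.2, p.1⟩) ?_ ?_ ?_ ?_ ?_
  · rintro ⟨v, u⟩ h
    simp only [mem_sigma, mem_nbrs] at h ⊢
    exact ⟨h.2.1, (hG _ _).1 h.2.2⟩
  · rintro ⟨u, e⟩ h
    simp only [mem_sigma] at h ⊢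
    have hadj : G.Adj u (u + e) := (hG _ _).2 (by simpa using h.2)
    have hm : u ∈ nbrs G S (u + e) := mem_nbrs.2 ⟨h.1, hadj⟩
    exact ⟨mem_boundarySet.2 ⟨fun hmem => hS _ h.1 _ hmem hadj, ne_empty_of_mem hm⟩, hm⟩
  · rintro ⟨v, u⟩ _
    simp
  · rintro ⟨u, e⟩ _
    simp
  · rintro ⟨v, u⟩ _
    simp

lemma sum_boundarySet_sub (hE : E.Nonempty) (hG : ∀ u v, G.Adj u v ↔ v - u ∈ E)
    (hS : activeSet G S = ∅) (g : V → ℝ) :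
    ∑ v ∈ boundarySet G S, ∑ u ∈ nbrs G S v, ∑ w ∈ S.erase u, (g (v - w) - g (u - w)) =
      2 * E.card * ∑ u ∈ S, ∑ w ∈ S.erase u, (lazyAvg E g (u - w) - g (u - w)) := by
  rw [sum_boundarySet_nbrs hG hS fun u v => ∑ w ∈ S.erase u, (g (v - w) - g (u - w)), mul_sum]
  refine sum_congr rfl fun u _ => ?_
  rw [sum_comm, mul_sum]
  refine sum_congr rfl fun w _ => ?_
  rw [← sum_sub_eq_lazyAvg hE]
  refine sum_congr rfl fun e _ => ?_
  rw [add_sub_right_comm]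

lemma card_adj_eq (hG : ∀ u v, G.Adj u v ↔ v - u ∈ E) (u : V) :
    (univ.filter fun v => G.Adj u v).card = E.card := by
  refine card_bij' (fun v _ => v - u) (fun e _ => u + e) ?_ ?_ (by simp) (by simp)
  · intro v hv
    simpa [hG] using hv
  · intro e he
    simpa [hG] using he

end PairEnergy

/-- The test function used to bound the time until a particle disappears. -/
def annihilationFn {V : Type*} [AddCommGroup V] (h : V → ℝ) (k : ℕ) (B : ℝ) (S : Finset V) : ℝ :=
  if S.card = k then pairEnergy h S else if S.card + 1 = k then B else 0

section Annihilation

variable {V : Type*} [AddCommGroup V] {h : V → ℝ} {k : ℕ} {B M : ℝ} {S : Finset V}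

lemma annihilationFn_nonneg (hh : ∀ x, 0 ≤ h x) (hB : 0 ≤ B) (S : Finset V) :
    0 ≤ annihilationFn h k B S := by
  unfold annihilationFn
  split_ifs
  · exact pairEnergy_nonneg hh
  · exact hB
  · exact le_rfl

lemma annihilationFn_le (hM : 0 ≤ M) (hhM : ∀ x, h x ≤ M) (hB : (k : ℝ) ^ 2 * M ≤ B)
    (S : Finset V) : annihilationFn h k B S ≤ B := by
  have h0 : 0 ≤ (k : ℝ) ^ 2 * M := by positivity
  unfold annihilationFn
  split_ifs with h1
  · have := pairEnergy_le (S := S) hM (fun u _ w _ _ => hhM (u - w))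
    rw [h1] at this
    linarith
  · exact le_rfl
  · linarith

variable {G : SimpleGraph V} [Fintype V]

lemma annihilationFn_deathAvg_ge (hh : ∀ x, h (-x) = h x) (hh0 : ∀ x, 0 ≤ h x) (hM : 0 ≤ M)
    (hhM : ∀ x, h x ≤ M) (hB : B = (k : ℝ) ^ 2 * M * (k * (k + 1))) (hS : activeSet G S = ∅)
    (hk : S.card = k) {v : V} (hv : v ∈ boundarySet G S) :
    annihilationFn h k B S +
        (∑ u ∈ nbrs G S v, ∑ w ∈ S.erase u, (h (v - w) - h (u - w))) / 2 ≤
      deathAvg G (annihilationFn h k B) (insert v S) := by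
  obtain ⟨hvS, hN⟩ := mem_boundarySet.1 hv
  have hSk : annihilationFn h k B S = pairEnergy h S := if_pos hk
  obtain ⟨u, hu⟩ := nonempty_iff_ne_empty.2 hN
  have huS := (mem_nbrs.1 hu).1
  have hk1 : (S.erase u).card + 1 = k := by rw [card_erase_add_one huS, hk]
  have hvSu : v ∉ S.erase u := fun h => hvS (mem_of_mem_erase h)
  by_cases hone : nbrs G S v = {u}
  · rw [deathAvg_insert_of_nbrs_eq_singleton hS hvS hone, hone, sum_singleton, hSk]
    have h1 : annihilationFn h k B (insert v (S.erase u)) =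
        pairEnergy h (insert v (S.erase u)) := if_pos (by rw [card_insert_of_notMem hvSu, hk1])
    have h2 := pairEnergy_erase hh huS
    rw [h1, pairEnergy_insert hh hvSu, sum_sub_distrib]
    linarith
  · have hne : (nbrs G S v).erase u ≠ ∅ := by
      intro h'
      rw [erase_eq_empty_iff] at h'
      exact h'.elim hN hone
    have hne' : nbrs G (S.erase u) v ≠ ∅ := by rwa [nbrs_erase]
    have hS' := activeSet_empty_mono hS (erase_subset u S)
    have hB0 : 0 ≤ B := by rw [hB]; positivity
    have hf0 := annihilationFn_nonneg (k := k) hh0 hB0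
    have a1 : u ∈ activeSet G (insert v S) := by
      rw [activeSet_insert hS hN]; exact mem_insert_of_mem hu
    have a2 : v ∈ activeSet G (insert v (S.erase u)) := by
      rw [activeSet_insert hS' hne']; exact mem_insert_self _ _
    have b1 := deathAvg_ge_erase hf0 a1
    have b2 := deathAvg_ge_erase hf0 a2
    have huv : v ≠ u := by rintro rfl; exact hvS huS
    rw [erase_insert_of_ne huv, card_insert_of_notMem hvS, hk] at b1
    rw [erase_insert hvSu, card_insert_of_notMem hvSu, hk1, deathAvg_of_stable hS'] at b2
    have hf1 : annihilationFn h k B (S.erase u) = B := by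
      rw [annihilationFn, if_neg (by omega), if_pos hk1]
    have hk0 : (0 : ℝ) < k := by exact_mod_cast (by omega : 0 < k)
    rw [hf1] at b2
    have b3 : (k : ℝ) ^ 2 * M * (k + 1) ≤
        deathAvg G (annihilationFn h k B) (insert v (S.erase u)) := by
      refine le_trans (le_of_eq ?_) b2
      rw [eq_div_iff hk0.ne', hB]
      ring
    have b4 : (k : ℝ) ^ 2 * M ≤ deathAvg G (annihilationFn h k B) (insert v S) := by
      refine le_trans ?_ b1
      rw [le_div_iff₀ (by positivity)]
      push_cast
      exact b3
    have c1 := pairEnergy_le (S := S) hM (fun u _ w _ _ => hhM (u - w))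
    have c2 : ∑ u ∈ nbrs G S v, ∑ w ∈ S.erase u, (h (v - w) - h (u - w)) ≤ (k : ℝ) ^ 2 * M := by
      calc _ ≤ ∑ u ∈ nbrs G S v, (k : ℝ) * M := by
            refine sum_le_sum fun u _ => ?_
            calc _ ≤ (S.erase u).card • M := sum_le_card_nsmul _ _ _ fun w _ => by
                  have := hhM (v - w)
                  have := hh0 (u - w)
                  linarith
              _ ≤ k * M := by
                  rw [nsmul_eq_mul, ← hk]
                  gcongr
                  exact erase_subset _ _
        _ = (nbrs G S v).card * (k * M) := by rw [sum_const, nsmul_eq_mul]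
        _ ≤ k * (k * M) := by
            gcongr
            rw [← hk]
            exact card_le_card (filter_subset _ _)
        _ = _ := by ring
    rw [hk] at c1
    linarith

lemma card_nbrs_eq_one_of_heat {E : Finset V} (hEn : ∀ e ∈ E, -e ∈ E)
    (hG : ∀ u v, G.Adj u v ↔ v - u ∈ E) {R : ℕ} (hR : 2 ≤ R)
    (hfar : ∀ u ∈ S, ∀ w ∈ S, u ≠ w → heat E R (u - w) = 0) {v : V}
    (hv : v ∈ boundarySet G S) : ∃ u, nbrs G S v = {u} := by
  obtain ⟨u, hu⟩ := nonempty_iff_ne_empty.2 (mem_boundarySet.1 hv).2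
  refine ⟨u, eq_singleton_iff_unique_mem.2 ⟨hu, fun w hw => ?_⟩⟩
  by_contra hne
  rw [mem_nbrs, hG] at hu hw
  have h1 := heat_two_pos hEn hu.2 (hEn _ hw.2)
  have h2 := heat_pos_of_le hR h1
  rw [show v - u + -(v - w) = w - u by abel] at h2
  exact h2.ne' (hfar _ hw.1 _ hu.1 hne)

/-- The drift of `annihilationFn`. -/
lemma annihilationFn_drift {E : Finset V} (hE : E.Nonempty) (hEn : ∀ e ∈ E, -e ∈ E)
    (hG : ∀ u v, G.Adj u v ↔ v - u ∈ E) {R : ℕ} (hR : 2 ≤ R) (hk2 : 2 ≤ k)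
    (hh : ∀ x, h (-x) = h x) (hh0 : ∀ x, 0 ≤ h x) (hM : 0 ≤ M)
    (hhM : ∀ x, h x ≤ M)
    (hdiff : ∀ x, x ≠ 0 → lazyAvg E h x - h x = heat E R x + 1 / Fintype.card V)
    {σ : ℝ} (hσ : 0 ≤ σ)
    (hfar : ∀ x, heat E R x = 0 → h x ≤ σ ∧ ∀ e ∈ E, h (x + e) ≤ σ)
    (hB : B = (k : ℝ) ^ 2 * M * (k * (k + 1))) {Λ : ℝ} (hΛ : 0 ≤ Λ)
    (hΛσ : (Λ * (E.card * k) + 1) * ((k : ℝ) ^ 2 * σ) ≤ 2 * E.card)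
    (hnB : (Λ * (E.card * k) + 1) * B ≤
      Fintype.card V * (E.card * (1 / (2 * E.card : ℝ)) ^ R))
    (hS : activeSet G S = ∅) (hk : S.card = k) :
    annihilationFn h k B S ≤ ∑ v ∈ boundarySet G S,
      (Fintype.card V * (deathAvg G (annihilationFn h k B) (insert v S) -
        annihilationFn h k B S) - Λ * deathAvg G (annihilationFn h k B) (insert v S)) := by
  set f := annihilationFn h k B with hf
  set n : ℝ := (Fintype.card V : ℝ) with hndef
  have hn0 : 0 < n := by rw [hndef]; exact_mod_cast Fintype.card_pos
  have hD : (1 : ℝ) ≤ E.card := by exact_mod_cast Finset.card_pos.2 hE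
  have hbd : ((boundarySet G S).card : ℝ) ≤ E.card * k := by
    rw [← hk]
    exact_mod_cast card_boundarySet_le (fun u => (card_adj_eq hG u).le) S
  -- the gain
  have hgain : n * (E.card * ∑ u ∈ S, ∑ w ∈ S.erase u, (heat E R (u - w) + 1 / n)) ≤
      ∑ v ∈ boundarySet G S, n * (deathAvg G f (insert v S) - f S) := by
    have h1 : ∑ v ∈ boundarySet G S,
        (∑ u ∈ nbrs G S v, ∑ w ∈ S.erase u, (h (v - w) - h (u - w))) / 2 ≤
        ∑ v ∈ boundarySet G S, (deathAvg G f (insert v S) - f S) := by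
      refine sum_le_sum fun v hv => ?_
      have := annihilationFn_deathAvg_ge hh hh0 hM hhM hB hS hk hv
      rw [← hf] at this
      linarith
    rw [← sum_div, sum_boundarySet_sub hE hG hS] at h1
    have h2 : ∑ u ∈ S, ∑ w ∈ S.erase u, (lazyAvg E h (u - w) - h (u - w)) =
        ∑ u ∈ S, ∑ w ∈ S.erase u, (heat E R (u - w) + 1 / n) :=
      sum_congr rfl fun u _ => sum_congr rfl fun w hw =>
        hdiff _ (sub_ne_zero.2 (ne_of_mem_erase hw).symm)
    rw [← mul_sum]
    refine mul_le_mul_of_nonneg_left ?_ hn0.le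
    rw [h2] at h1
    linarith
  rw [sum_sub_distrib]
  refine le_trans ?_ (sub_le_sub_right hgain _)
  have hcost : ∀ N : ℝ, 0 ≤ N → (∀ v ∈ boundarySet G S, deathAvg G f (insert v S) ≤ N) →
      ∑ v ∈ boundarySet G S, Λ * deathAvg G f (insert v S) ≤ Λ * (E.card * k) * N := by
    intro N hN hle
    calc _ ≤ (boundarySet G S).card • (Λ * N) :=
          sum_le_card_nsmul _ _ _ fun v hv => mul_le_mul_of_nonneg_left (hle v hv) hΛ
      _ ≤ (E.card * k) * (Λ * N) := by
          rw [nsmul_eq_mul]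
          gcongr
      _ = _ := by ring
  have hnonneg : ∀ u ∈ S, ∀ w ∈ S.erase u, 0 ≤ heat E R (u - w) + 1 / n := fun u _ w _ =>
    add_nonneg (heat_nonneg _ _) (by positivity)
  by_cases hnear : ∃ u ∈ S, ∃ w ∈ S, u ≠ w ∧ heat E R (u - w) ≠ 0
  · obtain ⟨u, hu, w, hw, huw, hpos⟩ := hnear
    have h1 : heat E R (u - w) + 1 / n ≤
        ∑ u ∈ S, ∑ w ∈ S.erase u, (heat E R (u - w) + 1 / n) :=
      (single_le_sum (f := fun w => heat E R (u - w) + 1 / n) (hnonneg u hu)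
        (mem_erase.2 ⟨huw.symm, hw⟩)).trans
      (single_le_sum (f := fun u => ∑ w ∈ S.erase u, (heat E R (u - w) + 1 / n))
        (fun u hu => sum_nonneg (hnonneg u hu)) hu)
    have h2 := (heat_eq_zero_or_ge hE R (u - w)).resolve_left hpos
    have h3 : 0 < 1 / n := by positivity
    have hkM : (k : ℝ) ^ 2 * M ≤ B := by
      rw [hB]
      have hk1 : (1 : ℝ) ≤ k := by exact_mod_cast (by omega : 1 ≤ k)
      have : (1 : ℝ) ≤ k * (k + 1) := by nlinarith
      exact le_mul_of_one_le_right (by positivity) this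
    have hB0 : 0 ≤ B := le_trans (by positivity) hkM
    have hfB : ∀ S, f S ≤ B := annihilationFn_le hM hhM hkM
    have h4 := hcost B hB0 fun v _ => deathAvg_le hfB _
    have h5 := hfB S
    have h6 : n * (E.card * (1 / (2 * E.card : ℝ)) ^ R) ≤
        n * (E.card * ∑ u ∈ S, ∑ w ∈ S.erase u, (heat E R (u - w) + 1 / n)) := by
      gcongr
      linarith
    linarith
  · push Not at hnear
    have h1 : (2 : ℝ) ≤ n * ∑ u ∈ S, ∑ w ∈ S.erase u, (heat E R (u - w) + 1 / n) := by
      have e1 : ∑ u ∈ S, ∑ w ∈ S.erase u, (1 / n) ≤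
          ∑ u ∈ S, ∑ w ∈ S.erase u, (heat E R (u - w) + 1 / n) :=
        sum_le_sum fun u _ => sum_le_sum fun w _ => by
          have := heat_nonneg (E := E) R (u - w)
          linarith
      have e2 : ∑ u ∈ S, ∑ w ∈ S.erase u, (1 / n) = k * ((k - 1) * (1 / n)) := by
        rw [sum_congr rfl fun u hu => (by
          rw [sum_const, card_erase_of_mem hu, hk, nsmul_eq_mul, Nat.cast_sub (by omega),
            Nat.cast_one] : ∑ w ∈ S.erase u, (1 / n) = ((k : ℝ) - 1) * (1 / n)),
          sum_const, nsmul_eq_mul, hk]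
      rw [e2] at e1
      have e3 := mul_le_mul_of_nonneg_left e1 hn0.le
      have e4 : n * (k * ((k - 1) * (1 / n))) = (k : ℝ) * (k - 1) := by field_simp
      have hk2' : (2 : ℝ) ≤ k := by exact_mod_cast hk2
      nlinarith
    have hfS : f S ≤ (k : ℝ) ^ 2 * σ := by
      rw [hf, annihilationFn, if_pos hk]
      have := pairEnergy_le (S := S) hσ fun u hu w hw huw => (hfar _ (hnear u hu w hw huw)).1
      rw [hk] at this
      have : 0 ≤ (k : ℝ) ^ 2 * σ := by positivity
      linarith
    have hdeath : ∀ v ∈ boundarySet G S, deathAvg G f (insert v S) ≤ (k : ℝ) ^ 2 * σ := by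
      intro v hv
      obtain ⟨u, hu⟩ := card_nbrs_eq_one_of_heat hEn hG hR hnear hv
      have hvS := (mem_boundarySet.1 hv).1
      have huN : u ∈ nbrs G S v := by rw [hu]; exact mem_singleton_self u
      obtain ⟨huS, huv⟩ := mem_nbrs.1 huN
      have hvSu : v ∉ S.erase u := fun h => hvS (mem_of_mem_erase h)
      rw [deathAvg_insert_of_nbrs_eq_singleton hS hvS hu]
      have hcard : (insert v (S.erase u)).card = k := by
        rw [card_insert_of_notMem hvSu, card_erase_add_one huS, hk]
      have hvw : ∀ w ∈ S.erase u, h (v - w) ≤ σ := by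
        intro w hw
        obtain ⟨hne, hwS⟩ := mem_erase.1 hw
        have := (hfar _ (hnear u huS w hwS hne.symm)).2 (v - u) ((hG _ _).1 huv)
        rwa [show u - w + (v - u) = v - w by abel] at this
      have h2 : f (insert v (S.erase u)) ≤ (k : ℝ) ^ 2 * σ := by
        rw [hf, annihilationFn, if_pos hcard]
        have := pairEnergy_le (S := insert v (S.erase u)) hσ fun a ha b hb hab => by
          rw [mem_insert] at ha hb
          rcases ha with rfl | ha <;> rcases hb with rfl | hb
          · exact absurd rfl hab
          · exact hvw _ hb
          · rw [← hh, neg_sub]; exact hvw _ ha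
          · exact (hfar _ (hnear _ (mem_of_mem_erase ha) _ (mem_of_mem_erase hb) hab)).1
        rw [hcard] at this
        have : 0 ≤ (k : ℝ) ^ 2 * σ := by positivity
        linarith
      linarith
    have h4 := hcost _ (by positivity) hdeath
    have h5 := mul_le_mul_of_nonneg_left h1 (by linarith : (0 : ℝ) ≤ E.card)
    have h6 : n * (E.card * ∑ u ∈ S, ∑ w ∈ S.erase u, (heat E R (u - w) + 1 / n)) =
      E.card * (n * ∑ u ∈ S, ∑ w ∈ S.erase u, (heat E R (u - w) + 1 / n)) := by ring
    linarith

end Annihilation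

/-- The test function used to bound the time until a new particle appears. -/
def creationFn {V : Type*} [AddCommGroup V] (H : V → ℝ) (lam : ℝ) (k : ℕ) (S : Finset V) : ℝ :=
  if 1 ≤ S.card ∧ S.card ≤ k + 1 then Real.exp (lam * (S.card - pairEnergy H S)) else 0

section Creation

variable {V : Type*} [AddCommGroup V] {H : V → ℝ} {lam : ℝ} {k : ℕ} {S T : Finset V} {v : V}

lemma creationFn_nonneg (S : Finset V) : 0 ≤ creationFn H lam k S := by
  unfold creationFn
  split_ifs
  · exact (Real.exp_pos _).le
  · exact le_rfl

lemma creationFn_of_card (h1 : 1 ≤ S.card) (h2 : S.card ≤ k + 1) :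
    creationFn H lam k S = Real.exp (lam * (S.card - pairEnergy H S)) := if_pos ⟨h1, h2⟩

lemma creationFn_le (hH : ∀ x, 0 ≤ H x) (hlam : 0 ≤ lam) (S : Finset V) :
    creationFn H lam k S ≤ Real.exp (lam * (k + 1)) := by
  unfold creationFn
  split_ifs with h
  · have h1 := pairEnergy_nonneg (S := S) hH
    have h2 : (S.card : ℝ) ≤ k + 1 := by exact_mod_cast h.2
    gcongr
    linarith
  · exact (Real.exp_pos _).le

lemma le_creationFn {C : ℝ} (hC : 0 ≤ C) (hHC : ∀ x, H x ≤ C) (hlam : 0 ≤ lam)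
    (h1 : 1 ≤ S.card) (h2 : S.card ≤ k) :
    Real.exp (lam * (1 - (k : ℝ) ^ 2 * C)) ≤ creationFn H lam k S := by
  rw [creationFn_of_card h1 (by omega)]
  have h3 := pairEnergy_le (S := S) hC (fun u _ w _ _ => hHC (u - w))
  have h4 : (1 : ℝ) ≤ S.card := by exact_mod_cast h1
  have h5 : (S.card : ℝ) ^ 2 * C ≤ (k : ℝ) ^ 2 * C := by gcongr
  have h6 : 0 ≤ (S.card : ℝ) ^ 2 * C := by positivity
  gcongr
  linarith

variable {G : SimpleGraph V}

/-- Twice the average gain in `card - pairEnergy` along the dynamics started from a particle `v`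
added to a stable configuration. -/
def transferSum (G : SimpleGraph V) (H : V → ℝ) (T : Finset V) (v : V) : ℝ :=
  ∑ u ∈ nbrs G T v, ∑ w ∈ T.erase u, (H (u - w) - H (v - w))

lemma sum_transferSum_erase (T : Finset V) (v : V) :
    ∑ a ∈ nbrs G T v, transferSum G H (T.erase a) v =
      ((nbrs G T v).card - 1 : ℝ) * transferSum G H T v -
        ∑ u ∈ nbrs G T v, ∑ a ∈ (nbrs G T v).erase u, (H (u - a) - H (v - a)) := by
  set N := nbrs G T v with hN
  have hNT : N ⊆ T := filter_subset _ _
  have h1 : ∀ a ∈ N, transferSum G H (T.erase a) v =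
      ∑ u ∈ N.erase a, (∑ w ∈ T.erase u, (H (u - w) - H (v - w)) - (H (u - a) - H (v - a))) := by
    intro a ha
    unfold transferSum
    rw [nbrs_erase, ← hN]
    refine sum_congr rfl fun u hu => ?_
    rw [erase_right_comm, sum_erase_eq_sub]
    exact mem_erase.2 ⟨(ne_of_mem_erase hu).symm, hNT ha⟩
  rw [sum_congr rfl h1]
  have h2 : ∑ a ∈ N, ∑ u ∈ N.erase a,
        (∑ w ∈ T.erase u, (H (u - w) - H (v - w)) - (H (u - a) - H (v - a))) =
      ∑ u ∈ N, ∑ a ∈ N.erase u,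
        (∑ w ∈ T.erase u, (H (u - w) - H (v - w)) - (H (u - a) - H (v - a))) :=
    sum_comm' fun a u => by simp only [mem_erase]; tauto
  rw [h2]
  simp only [sum_sub_distrib (s := Finset.erase _ _), sum_const, nsmul_eq_mul]
  rw [sum_sub_distrib]
  congr 1
  rw [transferSum, mul_sum]
  refine sum_congr rfl fun u hu => ?_
  rw [card_erase_of_mem hu, Nat.cast_sub (card_pos.2 ⟨u, hu⟩), Nat.cast_one, sum_sub_distrib,
    ← hN]
  ring

lemma card_sub_pairEnergy_transfer {E : Finset V} (hG : ∀ u v, G.Adj u v ↔ v - u ∈ E)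
    (hHn : ∀ x, H (-x) = H x) (hH : ∀ x, 0 ≤ H x)
    (hH3 : ∀ e ∈ E, ∀ x, 2 ≤ 3 * H e - H x) (hN : 2 ≤ (nbrs G T v).card) :
    ((nbrs G T v).card + 1 : ℝ) * (T.card - pairEnergy H T + transferSum G H T v / 2) ≤
      (T.card - pairEnergy H T) + ∑ a ∈ nbrs G T v, (((T.erase a).card : ℝ) -
        pairEnergy H (T.erase a) + transferSum G H (T.erase a) v / 2) := by
  rw [sum_add_distrib, ← sum_div, sum_transferSum_erase]
  set N := nbrs G T v with hNdef
  have hNT : N ⊆ T := filter_subset _ _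
  have h1 : ∑ a ∈ N, (((T.erase a).card : ℝ) - pairEnergy H (T.erase a)) =
      N.card * (T.card - pairEnergy H T - 1) + ∑ a ∈ N, ∑ w ∈ T.erase a, H (a - w) := by
    rw [← nsmul_eq_mul, ← sum_const, ← sum_add_distrib]
    refine sum_congr rfl fun a ha => ?_
    rw [pairEnergy_erase hHn (hNT ha), card_erase_of_mem (hNT ha),
      Nat.cast_sub (card_pos.2 ⟨a, hNT ha⟩), Nat.cast_one]
    ring
  have h2 : transferSum G H T v = ∑ a ∈ N, ∑ w ∈ T.erase a, H (a - w) -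
      ∑ a ∈ N, ∑ w ∈ T.erase a, H (v - w) := by
    rw [← sum_sub_distrib]
    exact sum_congr rfl fun a _ => sum_sub_distrib _ _
  have h3 : ∑ a ∈ N, ∑ w ∈ N.erase a, H (v - w) ≤ ∑ a ∈ N, ∑ w ∈ T.erase a, H (v - w) :=
    sum_le_sum fun a _ => sum_le_sum_of_subset_of_nonneg (erase_subset_erase _ hNT)
      fun w _ _ => hH _
  have h4 : (N.card : ℝ) * 2 ≤ ∑ a ∈ N, ∑ w ∈ N.erase a, (3 * H (v - w) - H (a - w)) := by
    rw [← nsmul_eq_mul]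
    refine card_nsmul_le_sum _ _ _ fun a ha => ?_
    have hne : (N.erase a).Nonempty := by
      rw [← card_pos, card_erase_of_mem ha]
      omega
    obtain ⟨w, hw⟩ := hne
    have h5 : ∀ w ∈ N.erase a, 2 ≤ 3 * H (v - w) - H (a - w) := fun w hw =>
      hH3 _ ((hG _ _).1 (mem_nbrs.1 (mem_of_mem_erase hw)).2) _
    exact (h5 w hw).trans (single_le_sum (f := fun w => 3 * H (v - w) - H (a - w))
      (fun w hw => by linarith [h5 w hw]) hw)
  have h5 : ∑ a ∈ N, ∑ w ∈ N.erase a, (3 * H (v - w) - H (a - w)) =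
      2 * ∑ a ∈ N, ∑ w ∈ N.erase a, H (v - w) -
        ∑ a ∈ N, ∑ w ∈ N.erase a, (H (a - w) - H (v - w)) := by
    rw [mul_sum, ← sum_sub_distrib]
    refine sum_congr rfl fun a _ => ?_
    rw [mul_sum, ← sum_sub_distrib]
    exact sum_congr rfl fun w _ => by ring
  rw [h1, add_mul, sub_mul]
  linarith

lemma creationFn_deathAvg_ge {E : Finset V} (hG : ∀ u v, G.Adj u v ↔ v - u ∈ E)
    (hHn : ∀ x, H (-x) = H x) (hH : ∀ x, 0 ≤ H x)
    (hH3 : ∀ e ∈ E, ∀ x, 2 ≤ 3 * H e - H x) (hlam : 0 ≤ lam) (a : ℝ)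
    (hT : activeSet G T = ∅) (hvT : v ∉ T) (hTk : T.card ≤ k + 1) (hN : nbrs G T v ≠ ∅) :
    Real.exp (lam * a) *
        (1 + lam * (T.card - pairEnergy H T + transferSum G H T v / 2 - a)) ≤
      deathAvg G (creationFn H lam k) (insert v T) := by
  have hexp : ∀ b, Real.exp (lam * a) * (1 + lam * (b - a)) ≤ Real.exp (lam * b) := by
    intro b
    have h1 := Real.add_one_le_exp (lam * (b - a))
    have h2 : Real.exp (lam * b) = Real.exp (lam * a) * Real.exp (lam * (b - a)) := by
      rw [← Real.exp_add]; ring_nf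
    rw [h2]
    gcongr
    linarith
  induction hm : (nbrs G T v).card generalizing T with
  | zero => exact absurd (card_eq_zero.1 hm) hN
  | succ m ih =>
    have hT1 : 1 ≤ T.card := by
      have := card_le_card (filter_subset (fun u => G.Adj u v) T)
      change (nbrs G T v).card ≤ _ at this
      omega
    have hfT : Real.exp (lam * a) * (1 + lam * (T.card - pairEnergy H T - a)) ≤
        creationFn H lam k T := by
      rw [creationFn_of_card hT1 hTk]
      exact hexp _
    rcases Nat.eq_zero_or_pos m with rfl | hmpos
    · obtain ⟨u, hu⟩ := card_eq_one.1 hm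
      have huT : u ∈ T := (mem_nbrs.1 (hu ▸ mem_singleton_self u : u ∈ nbrs G T v)).1
      have hvTu : v ∉ T.erase u := fun h => hvT (mem_of_mem_erase h)
      have hcard : (insert v (T.erase u)).card = T.card := by
        rw [card_insert_of_notMem hvTu, card_erase_add_one huT]
      rw [deathAvg_insert_of_nbrs_eq_singleton hT hvT hu, transferSum, hu, sum_singleton,
        creationFn_of_card (S := insert v (T.erase u)) (by omega) (by omega), hcard,
        pairEnergy_insert hHn hvTu]
      have h1 := hexp (T.card - (pairEnergy H (T.erase u) + ∑ w ∈ T.erase u, H (v - w)))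
      have h2 := pairEnergy_erase hHn huT
      have h3 : (T.card : ℝ) - pairEnergy H T + (∑ w ∈ T.erase u, (H (u - w) - H (v - w))) / 2 =
          ((T.card - pairEnergy H T) +
            (T.card - (pairEnergy H (T.erase u) + ∑ w ∈ T.erase u, H (v - w)))) / 2 := by
        rw [sum_sub_distrib]
        linarith
      rw [h3]
      linarith
    · have h1 := deathAvg_insert (f := creationFn H lam k) hT hvT hN
      have h2 := card_sub_pairEnergy_transfer hG hHn hH hH3 (T := T) (v := v) (by omega)
      have h3 : ∀ u ∈ nbrs G T v, Real.exp (lam * a) * (1 + lam *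
          ((T.erase u).card - pairEnergy H (T.erase u) + transferSum G H (T.erase u) v / 2 - a)) ≤
          deathAvg G (creationFn H lam k) (insert v (T.erase u)) := by
        intro u hu
        have hc : (nbrs G (T.erase u) v).card = m := by
          rw [nbrs_erase, card_erase_of_mem hu]
          omega
        refine ih (activeSet_empty_mono hT (erase_subset _ _))
          (fun h => hvT (mem_of_mem_erase h)) ((card_le_card (erase_subset _ _)).trans hTk) ?_ hc
        rw [← card_pos.trans nonempty_iff_ne_empty]
        omega
      have h4 := sum_le_sum h3
      rw [← mul_sum, sum_add_distrib, sum_const, nsmul_one, ← mul_sum, sum_sub_distrib, sum_const,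
        nsmul_eq_mul] at h4
      set N : ℝ := ((nbrs G T v).card : ℝ)
      have hN0 : (0 : ℝ) < N + 1 := by positivity
      refine le_of_mul_le_mul_left ?_ hN0
      rw [h1]
      refine le_trans ?_ (add_le_add hfT h4)
      rw [← mul_add, mul_left_comm]
      refine mul_le_mul_of_nonneg_left ?_ (Real.exp_pos _).le
      have h5 := mul_le_mul_of_nonneg_left h2 hlam
      linarith

end Creation

section CreationDrift

variable {V : Type*} [AddCommGroup V] {H : V → ℝ} {lam : ℝ} {k : ℕ} {S : Finset V}

lemma creationFn_insert_of_far {E : Finset V} {G : SimpleGraph V} (hEn : ∀ e ∈ E, -e ∈ E)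
    (hG : ∀ u v, G.Adj u v ↔ v - u ∈ E) {R : ℕ} (hR : 3 ≤ R) (hlam : 0 ≤ lam)
    (hHn : ∀ x, H (-x) = H x) {σ γ : ℝ} (hσ : 0 ≤ σ)
    (hfar : ∀ x, heat E R x = 0 → ∀ e ∈ E, ∀ e' ∈ E, H (x + e + e') ≤ σ)
    {e₀ e₁ : V} (he₀ : e₀ ∈ E) (he₁ : e₁ ∈ E) (hne : e₀ + e₁ ≠ 0) (hnE : e₀ + e₁ ∉ E)
    (hγ : H (e₀ + e₁) ≤ 1 - γ) (hSk : S.card ≤ k)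
    (hSfar : ∀ u ∈ S, ∀ w ∈ S, u ≠ w → heat E R (u - w) = 0) {u : V} (hu : u ∈ S) :
    u + (e₀ + e₁) ∉ S ∧ nbrs G S (u + (e₀ + e₁)) = ∅ ∧
      creationFn H lam k S * Real.exp (lam * (γ - (k : ℝ) ^ 2 * σ)) ≤
        creationFn H lam k (insert (u + (e₀ + e₁)) S) := by
  have hw : u + (e₀ + e₁) ∉ S := by
    intro hw
    have h1 := hSfar _ hw _ hu fun h => hne (by simpa using h)
    have h2 := heat_pos_of_le (by omega : 2 ≤ R) (heat_two_pos hEn he₀ he₁)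
    rw [add_sub_cancel_left] at h1
    exact h2.ne' h1
  refine ⟨hw, ?_, ?_⟩
  · refine filter_eq_empty_iff.2 fun {a} ha hadj => ?_
    rw [hG] at hadj
    rcases eq_or_ne a u with rfl | hau
    · exact hnE (by simpa using hadj)
    · have h1 := hSfar _ ha _ hu hau
      have h2 := heat_pos_of_le hR (heat_three_pos hEn he₀ he₁ (hEn _ hadj))
      rw [show e₀ + e₁ + -(u + (e₀ + e₁) - a) = a - u by abel] at h2
      exact h2.ne' h1
  · have hS1 : 1 ≤ S.card := card_pos.2 ⟨u, hu⟩
    have hc : (insert (u + (e₀ + e₁)) S).card = S.card + 1 := card_insert_of_notMem hw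
    rw [creationFn_of_card hS1 (by omega), creationFn_of_card (by omega) (by omega), hc,
      pairEnergy_insert hHn hw, ← Real.exp_add, ← mul_add]
    have h1 : ∑ w ∈ S, H (u + (e₀ + e₁) - w) ≤ 1 - γ + (k : ℝ) ^ 2 * σ := by
      rw [← add_sum_erase _ _ hu, add_sub_cancel_left]
      refine add_le_add hγ ?_
      calc _ ≤ (S.erase u).card • σ := sum_le_card_nsmul _ _ _ fun w hw => by
            obtain ⟨hwu, hwS⟩ := mem_erase.1 hw
            have := hfar _ (hSfar u hu w hwS hwu.symm) e₀ he₀ e₁ he₁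
            rwa [show u - w + e₀ + e₁ = u + (e₀ + e₁) - w by abel] at this
        _ ≤ (k : ℝ) ^ 2 * σ := by
          rw [nsmul_eq_mul]
          have h2 : (S.erase u).card ≤ k ^ 2 :=
            (card_le_card (erase_subset _ _)).trans (hSk.trans (Nat.le_self_pow two_ne_zero k))
          have h3 : ((S.erase u).card : ℝ) ≤ (k : ℝ) ^ 2 := by exact_mod_cast h2
          gcongr
    gcongr
    push_cast
    linarith

variable [Fintype V]

/-- The drift of `creationFn`. -/
lemma creationFn_drift {E : Finset V} {G : SimpleGraph V} (hE : E.Nonempty)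
    (hEn : ∀ e ∈ E, -e ∈ E) (hG : ∀ u v, G.Adj u v ↔ v - u ∈ E)
    {R : ℕ} (hR : 3 ≤ R) (hlam : 0 ≤ lam) (hHn : ∀ x, H (-x) = H x) (hH : ∀ x, 0 ≤ H x)
    {C₂ : ℝ} (hC₂ : 0 ≤ C₂) (hHC : ∀ x, H x ≤ C₂)
    (hH3 : ∀ e ∈ E, ∀ x, 2 ≤ 3 * H e - H x)
    (hneg : ∀ x, x ≠ 0 → -(16 * E.card) / (Fintype.card V : ℝ) ≤ H x - lazyAvg E H x)
    {κ : ℝ} (hκ : ∀ x, x ≠ 0 → 0 < heat E R x → κ ≤ H x - lazyAvg E H x)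
    {σ γ : ℝ} (hσ : 0 ≤ σ)
    (hfar : ∀ x, heat E R x = 0 → H x ≤ σ ∧ (∀ e ∈ E, H (x + e) ≤ σ) ∧
      ∀ e ∈ E, ∀ e' ∈ E, H (x + e + e') ≤ σ)
    {e₀ e₁ : V} (he₀ : e₀ ∈ E) (he₁ : e₁ ∈ E) (hne : e₀ + e₁ ≠ 0) (hnE : e₀ + e₁ ∉ E)
    (hγ : H (e₀ + e₁) ≤ 1 - γ) {Λ b : ℝ} (hΛ : 0 ≤ Λ) (hb : 0 ≤ b)
    (hbΛ : 16 * lam * (E.card : ℝ) ^ 2 * (k : ℝ) ^ 2 +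
      Λ * (E.card * k) * Real.exp (lam * ((k : ℝ) ^ 2 * σ)) + 1 ≤ b / 2)
    (hnB : (1 + 16 * lam * (E.card : ℝ) ^ 2 * (k : ℝ) ^ 2 + Λ * (E.card * k)) *
      Real.exp (lam * (k + 1)) ≤
      Fintype.card V * (lam * E.card * κ * Real.exp (lam * (1 - (k : ℝ) ^ 2 * C₂))))
    (hS : activeSet G S = ∅) (hS1 : 1 ≤ S.card) (hSk : S.card ≤ k) :
    creationFn H lam k S ≤ ∑ v ∈ boundarySet G S,
      (Fintype.card V * (deathAvg G (creationFn H lam k) (insert v S) - creationFn H lam k S) -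
        Λ * deathAvg G (creationFn H lam k) (insert v S) +
        if HasGoodBirth G (creationFn H lam k) (k + 2)
            (Real.exp (lam * (γ - 2 * ((k : ℝ) ^ 2 * σ))) / (k + 2)) (insert v S)
          then b * deathAvg G (creationFn H lam k) (insert v S) else 0) := by
  set f := creationFn H lam k with hf
  set n : ℝ := (Fintype.card V : ℝ) with hndef
  set τ : ℝ := (k : ℝ) ^ 2 * σ with hτ
  have hτ0 : 0 ≤ τ := by positivity
  have hn0 : 0 < n := by rw [hndef]; exact_mod_cast Fintype.card_pos
  have hD : (1 : ℝ) ≤ E.card := by exact_mod_cast Finset.card_pos.2 hE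
  have hf0 : ∀ X, 0 ≤ f X := creationFn_nonneg
  have hfS : f S = Real.exp (lam * (S.card - pairEnergy H S)) :=
    creationFn_of_card hS1 (by omega)
  have hfpos : 0 < f S := hfS ▸ Real.exp_pos _
  have hcard : (S.card : ℝ) ≤ k := by exact_mod_cast hSk
  have hbd : ((boundarySet G S).card : ℝ) ≤ E.card * k := by
    have : ((boundarySet G S).card : ℝ) ≤ E.card * S.card := by
      exact_mod_cast card_boundarySet_le (fun u => (card_adj_eq hG u).le) S
    exact this.trans (by gcongr)
  set Q : ℝ := ∑ u ∈ S, ∑ w ∈ S.erase u, (H (u - w) - lazyAvg E H (u - w)) with hQ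
  have hgain : n * (lam * E.card * Q * f S) ≤
      ∑ v ∈ boundarySet G S, n * (deathAvg G f (insert v S) - f S) := by
    have h1 : ∀ v ∈ boundarySet G S, f S * (lam * (transferSum G H S v / 2)) ≤
        deathAvg G f (insert v S) - f S := by
      intro v hv
      obtain ⟨hvS, hN⟩ := mem_boundarySet.1 hv
      have := creationFn_deathAvg_ge hG hHn hH hH3 hlam (S.card - pairEnergy H S) hS hvS
        (by omega : S.card ≤ k + 1) hN
      rw [← hfS, ← hf] at this
      linarith
    have h2 := sum_boundarySet_sub hE hG hS H
    have h3 : ∑ v ∈ boundarySet G S, transferSum G H S v = 2 * E.card * Q := by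
      have e1 : ∑ v ∈ boundarySet G S, transferSum G H S v =
          -∑ v ∈ boundarySet G S, ∑ u ∈ nbrs G S v, ∑ w ∈ S.erase u, (H (v - w) - H (u - w)) := by
        simp only [transferSum, ← sum_neg_distrib, neg_sub]
      have e2 : Q = -∑ u ∈ S, ∑ w ∈ S.erase u, (lazyAvg E H (u - w) - H (u - w)) := by
        simp only [hQ, ← sum_neg_distrib, neg_sub]
      rw [e1, h2, e2]
      ring
    rw [← mul_sum]
    refine mul_le_mul_of_nonneg_left (le_trans (le_of_eq ?_) (sum_le_sum h1)) hn0.le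
    rw [← mul_sum, ← mul_sum, ← sum_div, h3]
    ring
  have hnn : ∀ u ∈ S, ∀ w ∈ S.erase u,
      0 ≤ H (u - w) - lazyAvg E H (u - w) + 16 * E.card / n := fun u _ w hw => by
    have h1 := hneg _ (sub_ne_zero.2 (ne_of_mem_erase hw).symm)
    rw [neg_div] at h1
    linarith
  have hQ' : ∑ u ∈ S, ∑ w ∈ S.erase u, (H (u - w) - lazyAvg E H (u - w) + 16 * E.card / n) ≤
      Q + (k : ℝ) ^ 2 * (16 * E.card / n) := by
    simp only [sum_add_distrib]
    refine add_le_add le_rfl ?_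
    calc _ ≤ ∑ u ∈ S, (k : ℝ) * (16 * E.card / n) := by
          refine sum_le_sum fun u _ => ?_
          rw [sum_const, nsmul_eq_mul]
          have h2 : ((S.erase u).card : ℝ) ≤ k := by
            exact_mod_cast (card_le_card (erase_subset _ _)).trans hSk
          gcongr
      _ = S.card * (k * (16 * E.card / n)) := by rw [sum_const, nsmul_eq_mul]
      _ ≤ k * (k * (16 * E.card / n)) := by gcongr
      _ = _ := by ring
  have hloss : n * (lam * E.card * ((k : ℝ) ^ 2 * (16 * E.card / n)) * f S) =
      16 * lam * (E.card : ℝ) ^ 2 * (k : ℝ) ^ 2 * f S := by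
    field_simp
  have hcost : ∀ N : ℝ, 0 ≤ N → (∀ v ∈ boundarySet G S, deathAvg G f (insert v S) ≤ N) →
      ∑ v ∈ boundarySet G S, Λ * deathAvg G f (insert v S) ≤ Λ * (E.card * k) * N := by
    intro N hN hle
    calc _ ≤ (boundarySet G S).card • (Λ * N) :=
          sum_le_card_nsmul _ _ _ fun v hv => mul_le_mul_of_nonneg_left (hle v hv) hΛ
      _ ≤ (E.card * k) * (Λ * N) := by
          rw [nsmul_eq_mul]
          gcongr
      _ = _ := by ring
  rw [sum_add_distrib, sum_sub_distrib]
  have hbonus : ∀ v ∈ boundarySet G S, 0 ≤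
      if HasGoodBirth G f (k + 2) (Real.exp (lam * (γ - 2 * τ)) / (k + 2)) (insert v S)
        then b * deathAvg G f (insert v S) else 0 := fun v _ => by
    split_ifs
    · exact mul_nonneg hb (deathAvg_nonneg hf0 _)
    · exact le_rfl
  have hlD : 0 ≤ lam * E.card := by positivity
  by_cases hnear : ∃ u ∈ S, ∃ w ∈ S, u ≠ w ∧ heat E R (u - w) ≠ 0
  · obtain ⟨u, hu, w, hw, huw, hpos⟩ := hnear
    have h1 := (single_le_sum (hnn u hu) (mem_erase.2 ⟨huw.symm, hw⟩)).trans
      ((single_le_sum (f := fun u => ∑ w ∈ S.erase u,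
        (H (u - w) - lazyAvg E H (u - w) + 16 * E.card / n))
        (fun u hu => sum_nonneg (hnn u hu)) hu).trans hQ')
    have h2 := hκ _ (sub_ne_zero.2 huw) ((heat_nonneg _ _).lt_of_ne' hpos)
    have h3 : 0 ≤ 16 * (E.card : ℝ) / n := by positivity
    have h4 : κ - (k : ℝ) ^ 2 * (16 * E.card / n) ≤ Q := by linarith
    have h5 : n * (lam * E.card * (κ - (k : ℝ) ^ 2 * (16 * E.card / n)) * f S) ≤
        n * (lam * E.card * Q * f S) := by gcongr
    have hfle : ∀ X, f X ≤ Real.exp (lam * (k + 1)) := creationFn_le hH hlam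
    have h6 := hcost _ (Real.exp_pos _).le fun v _ => deathAvg_le hfle (insert v S)
    have h7 : Real.exp (lam * (1 - (k : ℝ) ^ 2 * C₂)) ≤ f S := le_creationFn hC₂ hHC hlam hS1 hSk
    have h8 := sum_nonneg hbonus
    have hA : 0 ≤ 1 + 16 * lam * (E.card : ℝ) ^ 2 * (k : ℝ) ^ 2 := by positivity
    have h9 := mul_le_mul_of_nonneg_left (hfle S) hA
    have hκ0 : 0 ≤ n * (lam * E.card * κ) := by
      by_contra hlt
      push Not at hlt
      have e1 : 0 ≤ (1 + 16 * lam * (E.card : ℝ) ^ 2 * (k : ℝ) ^ 2 + Λ * (E.card * k)) *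
        Real.exp (lam * (k + 1)) := by positivity
      have e2 := mul_neg_of_neg_of_pos hlt (Real.exp_pos (lam * (1 - (k : ℝ) ^ 2 * C₂)))
      linarith
    have h10 := mul_le_mul_of_nonneg_left h7 hκ0
    have h11 : n * (lam * E.card * (κ - (k : ℝ) ^ 2 * (16 * E.card / n)) * f S) =
      n * (lam * E.card * κ) * f S - 16 * lam * (E.card : ℝ) ^ 2 * (k : ℝ) ^ 2 * f S := by
      rw [← hloss]; ring
    linarith
  · push Not at hnear
    have h1 : -((k : ℝ) ^ 2 * (16 * E.card / n)) ≤ Q := by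
      have := (sum_nonneg fun u hu => sum_nonneg (hnn u hu)).trans hQ'
      linarith
    have h2 : n * (lam * E.card * -((k : ℝ) ^ 2 * (16 * E.card / n)) * f S) ≤
        n * (lam * E.card * Q * f S) := by gcongr
    have hbounds : ∀ v ∈ boundarySet G S, f S / 2 ≤ deathAvg G f (insert v S) ∧
        deathAvg G f (insert v S) ≤ Real.exp (lam * τ) * f S := by
      intro v hv
      obtain ⟨u, hu⟩ := card_nbrs_eq_one_of_heat hEn hG (by omega) hnear hv
      have hvS := (mem_boundarySet.1 hv).1
      have huN : u ∈ nbrs G S v := by rw [hu]; exact mem_singleton_self u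
      obtain ⟨huS, huv⟩ := mem_nbrs.1 huN
      have hvSu : v ∉ S.erase u := fun h => hvS (mem_of_mem_erase h)
      rw [deathAvg_insert_of_nbrs_eq_singleton hS hvS hu]
      have hc : (insert v (S.erase u)).card = S.card := by
        rw [card_insert_of_notMem hvSu, card_erase_add_one huS]
      have h3 := hf0 (insert v (S.erase u))
      have h4 : f (insert v (S.erase u)) ≤ Real.exp (lam * τ) * f S := by
        rw [hf, creationFn_of_card (by omega) (by omega), hc, creationFn_of_card hS1 (by omega),
          ← Real.exp_add, ← mul_add]
        have h5 := pairEnergy_nonneg (S := insert v (S.erase u)) hH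
        have h6 := pairEnergy_le (S := S) hσ fun u hu w hw huw =>
          (hfar _ (hnear u hu w hw huw)).1
        have h7 : (S.card : ℝ) ^ 2 * σ ≤ τ := by rw [hτ]; gcongr
        have h8 : 0 ≤ (S.card : ℝ) ^ 2 * σ := by positivity
        gcongr
        linarith
      have h5 : f S ≤ Real.exp (lam * τ) * f S :=
        le_mul_of_one_le_left hfpos.le (Real.one_le_exp (by positivity))
      exact ⟨by linarith, by linarith⟩
    have h3 := hcost _ (by positivity) fun v hv => (hbounds v hv).2
    obtain ⟨u, hu⟩ := card_pos.1 hS1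
    obtain ⟨hwS, hwN, hwf⟩ := creationFn_insert_of_far hEn hG hR hlam hHn hσ
      (fun x hx => (hfar x hx).2.2) he₀ he₁ hne hnE hγ hSk hnear hu
    set w := u + (e₀ + e₁) with hw
    have hadj : G.Adj u (u + e₀) := (hG _ _).2 (by simpa using he₀)
    have hadj' : G.Adj (u + e₀) w := (hG _ _).2 (by rw [hw]; convert he₁ using 1; abel)
    have hvS : u + e₀ ∉ S := fun h => activeSet_eq_empty_iff.1 hS u hu _ h hadj
    set v := u + e₀ with hv
    have hvb : v ∈ boundarySet G S :=
      mem_boundarySet.2 ⟨hvS, nonempty_iff_ne_empty.1 ⟨u, mem_nbrs.2 ⟨hu, hadj⟩⟩⟩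
    have hgood : HasGoodBirth G f (k + 2) (Real.exp (lam * (γ - 2 * τ)) / (k + 2)) (insert v S) := by
      have hcv : (insert v S).card = S.card + 1 := card_insert_of_notMem hvS
      have hwv : w ∉ insert v S := by
        rw [mem_insert, not_or]
        exact ⟨hadj'.ne', hwS⟩
      refine ⟨by omega, w, mem_boundarySet.2 ⟨hwv, nonempty_iff_ne_empty.1
        ⟨v, mem_nbrs.2 ⟨mem_insert_self _ _, hadj'⟩⟩⟩, ?_⟩
      have hSw := activeSet_insert_of_nbrs_eq_empty hS hwN
      have hvw : v ∉ insert w S := by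
        rw [mem_insert, not_or]
        exact ⟨hadj'.ne, hvS⟩
      have hact : v ∈ activeSet G (insert v (insert w S)) := by
        rw [activeSet_insert hSw (nonempty_iff_ne_empty.1
          ⟨w, mem_nbrs.2 ⟨mem_insert_self _ _, hadj'.symm⟩⟩)]
        exact mem_insert_self _ _
      have h4 := deathAvg_ge_erase hf0 hact
      rw [erase_insert hvw, card_insert_of_notMem hvw, card_insert_of_notMem hwS,
        deathAvg_of_stable hSw, insert_comm] at h4
      have hle : (((S.card + 1 + 1 : ℕ)) : ℝ) ≤ k + 2 := by push_cast; linarith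
      calc _ ≤ Real.exp (lam * (γ - 2 * τ)) / (k + 2) * (Real.exp (lam * τ) * f S) := by
            have := (hbounds v hvb).2
            gcongr
        _ = f S * Real.exp (lam * (γ - τ)) / (k + 2) := by
            have : Real.exp (lam * (γ - τ)) = Real.exp (lam * (γ - 2 * τ)) * Real.exp (lam * τ) := by
              rw [← Real.exp_add]; ring_nf
            rw [this]
            ring
        _ ≤ f (insert w S) / (k + 2) := by gcongr
        _ ≤ f (insert w S) / ((S.card + 1 + 1 : ℕ) : ℝ) := by
            have := hf0 (insert w S)
            gcongr
        _ ≤ _ := h4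
    have h4 := single_le_sum hbonus hvb
    rw [if_pos hgood] at h4
    have h5 := mul_le_mul_of_nonneg_left (hbounds v hvb).1 hb
    have h6 := mul_le_mul_of_nonneg_right hbΛ hfpos.le
    have h11 : n * (lam * E.card * -((k : ℝ) ^ 2 * (16 * E.card / n)) * f S) =
      - (16 * lam * (E.card : ℝ) ^ 2 * (k : ℝ) ^ 2 * f S) := by
      rw [← hloss]; ring
    linarith

end CreationDrift

section TorusSteps

variable {L d : ℕ}

/-- The step `± e_i` of the torus. -/
def torusStep (L d : ℕ) (p : Fin d × Bool) : Fin d → ZMod L :=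
  Pi.single p.1 (if p.2 then 1 else -1)

/-- The set of steps `± e_i` of the torus. -/
def torusSteps (L d : ℕ) : Finset (Fin d → ZMod L) := univ.image (torusStep L d)

lemma torusStep_not (i : Fin d) (s : Bool) : torusStep L d (i, !s) = -torusStep L d (i, s) := by
  rw [torusStep, torusStep, ← Pi.single_neg]
  cases s <;> simp

lemma neg_mem_torusSteps {e : Fin d → ZMod L} (he : e ∈ torusSteps L d) :
    -e ∈ torusSteps L d := by
  obtain ⟨⟨i, s⟩, -, rfl⟩ := mem_image.1 he
  rw [← torusStep_not]
  exact mem_image_of_mem _ (mem_univ _)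

lemma torusStep_injective (hL : 3 ≤ L) : Function.Injective (torusStep L d) := by
  have : Fact (2 < L) := ⟨hL⟩
  have : Fact (1 < L) := ⟨by omega⟩
  have hne : ∀ s : Bool, (if s then (1 : ZMod L) else -1) ≠ 0 := by
    intro s
    cases s <;> simp
  rintro ⟨i, s⟩ ⟨j, t⟩ h
  have h1 := congrFun h i
  rw [torusStep, torusStep, Pi.single_eq_same] at h1
  by_cases hij : i = j
  · subst hij
    rw [Pi.single_eq_same] at h1
    have h2 := ZMod.neg_one_ne_one (n := L)
    cases s <;> cases t <;> simp_all [eq_comm]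
  · simp only at h1
    rw [Pi.single_eq_of_ne hij] at h1
    exact absurd h1 (hne s)

lemma card_torusSteps (hL : 3 ≤ L) : (torusSteps L d).card = 2 * d := by
  rw [torusSteps, card_image_of_injective _ (torusStep_injective hL)]
  simp [mul_comm]

lemma sum_torusSteps (hL : 3 ≤ L) (g : (Fin d → ZMod L) → ℝ) :
    ∑ e ∈ torusSteps L d, g e = ∑ i, (g (Pi.single i 1) + g (-Pi.single i 1)) := by
  rw [torusSteps, sum_image fun _ _ _ _ h => torusStep_injective hL h, Fintype.sum_prod_type]
  refine sum_congr rfl fun i _ => ?_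
  rw [Fintype.sum_bool, torusStep, torusStep, ← Pi.single_neg]
  simp

lemma zero_notMem_torusSteps (hL : 3 ≤ L) : (0 : Fin d → ZMod L) ∉ torusSteps L d := by
  intro h
  obtain ⟨⟨i, s⟩, -, h⟩ := mem_image.1 h
  have h1 : torusStep L d (i, !s) = torusStep L d (i, s) := by rw [torusStep_not, h, neg_zero]
  have := torusStep_injective hL h1
  simp at this

lemma torusGraph_adj (hL : 3 ≤ L) (u v : Fin d → ZMod L) :
    (torusGraph L d).Adj u v ↔ v - u ∈ torusSteps L d := by
  have hs : ∀ i : Fin d, (fun j => if j = i then (1 : ZMod L) else 0) = Pi.single i 1 := fun i => by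
    ext j
    rw [Pi.single_apply]
  have hiff : v - u ∈ torusSteps L d ↔
      ∃ i : Fin d, v - u = Pi.single i 1 ∨ v - u = -Pi.single i 1 := by
    simp only [torusSteps, mem_image, mem_univ, true_and, Prod.exists, Bool.exists_bool, torusStep,
      ← Pi.single_neg]
    simp only [eq_comm, if_true, Bool.false_eq_true, if_false, or_comm]
  rw [torusGraph, SimpleGraph.fromRel_adj, hiff]
  constructor
  · rintro ⟨-, ⟨i, hi⟩ | ⟨i, hi⟩⟩
    · exact ⟨i, Or.inl (by rw [hi, hs, add_sub_cancel_left])⟩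
    · exact ⟨i, Or.inr (by rw [hi, hs]; abel)⟩
  · rintro ⟨i, hi⟩
    refine ⟨?_, ?_⟩
    · rintro rfl
      have h0 := zero_notMem_torusSteps (d := d) hL
      rw [← sub_self u, hiff] at h0
      exact h0 ⟨i, hi⟩
    · rcases hi with hi | hi
      · exact Or.inl ⟨i, by rw [hs, ← hi]; abel⟩
      · exact Or.inr ⟨i, by rw [hs, ← neg_eq_iff_eq_neg.2 hi]; abel⟩

end TorusSteps

section TorusCharacters

variable {L d : ℕ} [NeZero L]

/-- The real part of the character of the torus with frequency `ξ`. -/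
def torusChar (ξ x : Fin d → ZMod L) : ℝ := (ZMod.stdAddChar (ξ ⬝ᵥ x)).re

/-- The eigenvalue of the lazy walk on the torus at the frequency `ξ`. -/
def torusEig (ξ : Fin d → ZMod L) : ℝ :=
  1 - (∑ i, (1 - (ZMod.stdAddChar (ξ i)).re)) / (2 * d)

lemma norm_stdAddChar (j : ZMod L) : ‖(ZMod.stdAddChar j : ℂ)‖ = 1 := by
  rw [ZMod.stdAddChar_apply]
  exact Circle.norm_coe _

lemma abs_torusChar_le (ξ x : Fin d → ZMod L) : |torusChar ξ x| ≤ 1 :=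
  (Complex.abs_re_le_norm _).trans (norm_stdAddChar _).le

lemma stdAddChar_neg (j : ZMod L) :
    (ZMod.stdAddChar (-j) : ℂ) = starRingEnd ℂ (ZMod.stdAddChar j) := by
  rw [AddChar.map_neg_eq_inv, Complex.inv_eq_conj (norm_stdAddChar j)]

lemma torusChar_neg (ξ x : Fin d → ZMod L) : torusChar ξ (-x) = torusChar ξ x := by
  rw [torusChar, dotProduct_neg, stdAddChar_neg, Complex.conj_re, torusChar]

lemma torusChar_zero (x : Fin d → ZMod L) : torusChar 0 x = 1 := by
  rw [torusChar, zero_dotProduct, AddChar.map_zero_eq_one, Complex.one_re]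

lemma torusChar_add_add_sub (ξ x e : Fin d → ZMod L) :
    torusChar ξ (x + e) + torusChar ξ (x + -e) = 2 * (ZMod.stdAddChar (ξ ⬝ᵥ e)).re *
      torusChar ξ x := by
  simp only [torusChar, dotProduct_add, dotProduct_neg, AddChar.map_add_eq_mul, stdAddChar_neg,
    Complex.mul_re, Complex.conj_re, Complex.conj_im]
  ring

lemma lazyAvg_torusChar (hL : 3 ≤ L) (hd : 1 ≤ d) (ξ x : Fin d → ZMod L) :
    lazyAvg (torusSteps L d) (torusChar ξ) x = torusEig ξ * torusChar ξ x := by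
  have hd0 : (d : ℝ) ≠ 0 := by exact_mod_cast (by omega : d ≠ 0)
  rw [lazyAvg, card_torusSteps hL, sum_torusSteps hL (fun e => torusChar ξ (x + e)), torusEig]
  simp only [torusChar_add_add_sub, dotProduct_single, mul_one, sum_sub_distrib, sum_const,
    ← sum_mul, ← mul_sum]
  rw [card_univ, Fintype.card_fin, nsmul_one]
  push_cast
  field_simp
  ring

lemma stdAddChar_sum {ι : Type*} (s : Finset ι) (g : ι → ZMod L) :
    (ZMod.stdAddChar (∑ i ∈ s, g i) : ℂ) = ∏ i ∈ s, ZMod.stdAddChar (g i) := by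
  induction s using Finset.induction_on with
  | empty => simp
  | insert i s hi ih => rw [sum_insert hi, prod_insert hi, AddChar.map_add_eq_mul, ih]

lemma sum_torusChar (x : Fin d → ZMod L) :
    ∑ ξ, torusChar ξ x = if x = 0 then (Fintype.card (Fin d → ZMod L) : ℝ) else 0 := by
  have h1 : ∑ ξ : Fin d → ZMod L, (ZMod.stdAddChar (ξ ⬝ᵥ x) : ℂ) =
      ∏ i, ∑ j : ZMod L, (ZMod.stdAddChar (j * x i) : ℂ) := by
    rw [prod_univ_sum, Fintype.piFinset_univ]
    refine sum_congr rfl fun ξ _ => ?_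
    rw [dotProduct, stdAddChar_sum]
  have h2 : ∑ ξ : Fin d → ZMod L, (ZMod.stdAddChar (ξ ⬝ᵥ x) : ℂ) =
      ((if x = 0 then (Fintype.card (Fin d → ZMod L) : ℝ) else 0 : ℝ) : ℂ) := by
    rw [h1]
    simp only [AddChar.sum_mulShift _ (ZMod.isPrimitive_stdAddChar L)]
    split_ifs with hx
    · subst hx
      simp
    · obtain ⟨i, hi⟩ := Function.ne_iff.1 hx
      rw [Complex.ofReal_zero]
      exact prod_eq_zero (mem_univ i) (by rw [if_neg (by simpa using hi)]; simp)
  have h3 := congrArg Complex.re h2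
  rwa [Complex.re_sum, Complex.ofReal_re] at h3

lemma abs_valMinAbs_div_le (j : ZMod L) : |(j.valMinAbs : ℝ) / L| ≤ 1 / 2 := by
  have hL : (0 : ℝ) < L := by exact_mod_cast NeZero.pos L
  have h3 := ZMod.valMinAbs_mem_Ioc j
  have h4 : -(L : ℝ) < (j.valMinAbs : ℝ) * 2 := by exact_mod_cast h3.1
  have h5 : (j.valMinAbs : ℝ) * 2 ≤ L := by exact_mod_cast h3.2
  rw [abs_le, le_div_iff₀ hL, div_le_iff₀ hL]
  constructor <;> linarith

lemma re_stdAddChar_le (j : ZMod L) :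
    (ZMod.stdAddChar j : ℂ).re ≤ 1 - 8 * ((j.valMinAbs : ℝ) / L) ^ 2 := by
  have h1 : (ZMod.stdAddChar j : ℂ).re = Real.cos (2 * Real.pi * (j.valMinAbs / L)) := by
    conv_lhs => rw [← ZMod.coe_valMinAbs j, ZMod.stdAddChar_coe]
    rw [← Complex.exp_ofReal_mul_I_re]
    congr 2
    push_cast
    ring
  have h2 := abs_valMinAbs_div_le j
  rw [h1]
  refine (Real.cos_le_one_sub_mul_cos_sq ?_).trans (le_of_eq ?_)
  · rw [abs_mul, abs_of_pos Real.two_pi_pos]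
    nlinarith [Real.pi_pos]
  · have := Real.pi_ne_zero
    field_simp
    ring

lemma torusEig_nonneg (hd : 1 ≤ d) (ξ : Fin d → ZMod L) : 0 ≤ torusEig ξ := by
  have hd0 : (0 : ℝ) < d := by exact_mod_cast hd
  have h1 : ∑ i, (1 - (ZMod.stdAddChar (ξ i) : ℂ).re) ≤ ∑ _i : Fin d, (2 : ℝ) :=
    sum_le_sum fun i _ => by
      have h2 := (Complex.abs_re_le_norm _).trans (norm_stdAddChar (ξ i)).le
      rw [abs_le] at h2
      linarith
  rw [sum_const, card_univ, Fintype.card_fin, nsmul_eq_mul] at h1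
  rw [torusEig, sub_nonneg, div_le_one (by positivity)]
  linarith

lemma le_one_sub_torusEig (hd : 1 ≤ d) (ξ : Fin d → ZMod L) (i : Fin d) :
    4 / d * (((ξ i).valMinAbs : ℝ) / L) ^ 2 ≤ 1 - torusEig ξ := by
  have hd0 : (0 : ℝ) < d := by exact_mod_cast hd
  have h1 : 8 * (((ξ i).valMinAbs : ℝ) / L) ^ 2 ≤
      ∑ i, (1 - (ZMod.stdAddChar (ξ i) : ℂ).re) := by
    refine le_trans ?_ (single_le_sum (f := fun i => 1 - (ZMod.stdAddChar (ξ i) : ℂ).re)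
      (fun i _ => ?_) (mem_univ i))
    · linarith [re_stdAddChar_le (ξ i)]
    · have h2 := (Complex.abs_re_le_norm _).trans (norm_stdAddChar (ξ i)).le
      linarith [(abs_le.1 h2).2]
  rw [torusEig, sub_sub_cancel, le_div_iff₀ (by positivity)]
  refine le_trans (le_of_eq ?_) h1
  field_simp
  ring

end TorusCharacters

section TorusGreen

variable {L d : ℕ} [NeZero L]

/-- The image under `s` steps of the lazy walk of the Green function of the torus. -/
def torusGreen (L d : ℕ) [NeZero L] (s : ℕ) (x : Fin d → ZMod L) : ℝ :=
  (Fintype.card (Fin d → ZMod L) : ℝ)⁻¹ *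
    ∑ ξ ∈ univ.erase (0 : Fin d → ZMod L),
      torusEig ξ ^ s / (1 - torusEig ξ) * torusChar ξ x

lemma sq_valMinAbs_div_pos {j : ZMod L} (hj : j ≠ 0) : 0 < ((j.valMinAbs : ℝ) / L) ^ 2 := by
  have hL : (0 : ℝ) < L := by exact_mod_cast NeZero.pos L
  have h : (j.valMinAbs : ℝ) ≠ 0 := by exact_mod_cast (ZMod.valMinAbs_eq_zero j).not.2 hj
  positivity

lemma one_sub_torusEig_pos (hd : 1 ≤ d) {ξ : Fin d → ZMod L} (hξ : ξ ≠ 0) :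
    0 < 1 - torusEig ξ := by
  have hd0 : (0 : ℝ) < d := by exact_mod_cast hd
  obtain ⟨i, hi⟩ := Function.ne_iff.1 hξ
  refine lt_of_lt_of_le ?_ (le_one_sub_torusEig hd ξ i)
  have := sq_valMinAbs_div_pos (j := ξ i) hi
  positivity

lemma lazyAvg_torusGreen (hL : 3 ≤ L) (hd : 1 ≤ d) (s : ℕ) :
    lazyAvg (torusSteps L d) (torusGreen L d s) = torusGreen L d (s + 1) := by
  ext x
  unfold torusGreen
  rw [lazyAvg_mul, lazyAvg_sum]
  congr 1
  refine sum_congr rfl fun ξ _ => ?_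
  rw [lazyAvg_mul, lazyAvg_torusChar hL hd]
  ring

lemma iterate_lazyAvg_torusGreen (hL : 3 ≤ L) (hd : 1 ≤ d) (s : ℕ) :
    (lazyAvg (torusSteps L d))^[s] (torusGreen L d 0) = torusGreen L d s := by
  induction s with
  | zero => rfl
  | succ s ih => rw [Function.iterate_succ_apply', ih, lazyAvg_torusGreen hL hd]

lemma isGreen_torusGreen (hL : 3 ≤ L) (hd : 1 ≤ d) :
    IsGreen (torusSteps L d) (torusGreen L d 0) where
  neg x := by simp only [torusGreen, torusChar_neg]
  eq x := by
    have hn : (Fintype.card (Fin d → ZMod L) : ℝ) ≠ 0 := by exact_mod_cast Fintype.card_ne_zero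
    rw [lazyAvg_torusGreen hL hd, torusGreen, torusGreen, ← mul_sub, ← sum_sub_distrib]
    have h1 : ∀ ξ ∈ univ.erase (0 : Fin d → ZMod L),
        torusEig ξ ^ 0 / (1 - torusEig ξ) * torusChar ξ x -
          torusEig ξ ^ (0 + 1) / (1 - torusEig ξ) * torusChar ξ x = torusChar ξ x := by
      intro ξ hξ
      have := one_sub_torusEig_pos hd (ne_of_mem_erase hξ)
      field_simp
      ring
    rw [sum_congr rfl h1, sum_erase_eq_sub (mem_univ _), sum_torusChar, torusChar_zero, heat_zero]
    split_ifs
    · field_simp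
    · field_simp
      ring

lemma card_valMinAbs_le (A : ℕ) :
    (univ.filter fun j : ZMod L => j.valMinAbs.natAbs ≤ A).card ≤ 2 * A + 1 := by
  have h : ((univ.filter fun j : ZMod L => j.valMinAbs.natAbs ≤ A).image ZMod.valMinAbs) ⊆
      Finset.Icc (-(A : ℤ)) A := by
    intro a ha
    simp only [mem_image, mem_filter, mem_univ, true_and] at ha
    obtain ⟨j, hj, rfl⟩ := ha
    rw [Finset.mem_Icc]
    omega
  have h1 := card_le_card h
  rw [card_image_of_injective _ ZMod.injective_valMinAbs, Int.card_Icc] at h1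
  omega

/-- The frequencies whose largest coordinate is the `i`-th one, equal to `j`. -/
def dominatedFreqs (i : Fin d) (j : ZMod L) : Finset (Fin d → ZMod L) :=
  univ.filter fun ξ => ξ i = j ∧ ∀ i', (ξ i').valMinAbs.natAbs ≤ j.valMinAbs.natAbs

lemma card_dominatedFreqs_le (i : Fin d) (j : ZMod L) :
    (dominatedFreqs i j).card ≤ (2 * j.valMinAbs.natAbs + 1) ^ (d - 1) := by
  set t : Fin d → Finset (ZMod L) := fun i' => if i' = i then {j} else
    univ.filter fun l : ZMod L => l.valMinAbs.natAbs ≤ j.valMinAbs.natAbs with ht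
  have hsub : dominatedFreqs i j ⊆ Fintype.piFinset t := by
    intro ξ hξ
    simp only [dominatedFreqs, mem_filter, mem_univ, true_and] at hξ
    rw [Fintype.mem_piFinset]
    intro i'
    rw [ht]
    by_cases h : i' = i
    · simp [h, hξ.1]
    · simp [h, hξ.2 i']
  refine (card_le_card hsub).trans ?_
  rw [Fintype.card_piFinset, ← mul_prod_erase _ _ (mem_univ i)]
  have h1 : (t i).card = 1 := by simp [ht]
  have h2 : (univ.erase i).card = d - 1 := by rw [card_erase_of_mem (mem_univ _)]; simp
  rw [h1, one_mul, ← h2]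
  refine prod_le_pow_card _ _ _ fun i' hi' => ?_
  rw [ht]
  simp only [ne_of_mem_erase hi', if_false]
  exact card_valMinAbs_le _

lemma sum_le_sum_dominatedFreqs (hd : 1 ≤ d) {F : (Fin d → ZMod L) → ℝ}
    (hF : ∀ ξ, ξ ≠ 0 → 0 ≤ F ξ) :
    ∑ ξ ∈ univ.erase 0, F ξ ≤
      ∑ i : Fin d, ∑ j ∈ univ.erase (0 : ZMod L), ∑ ξ ∈ dominatedFreqs i j, F ξ := by
  have hne : ∀ (i : Fin d) (j : ZMod L), j ≠ 0 → ∀ ξ ∈ dominatedFreqs i j, ξ ≠ 0 := by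
    intro i j hj ξ hξ h0
    simp only [dominatedFreqs, mem_filter] at hξ
    exact hj (by rw [← hξ.2.1, h0, Pi.zero_apply])
  have h1 : ∀ ξ ∈ univ.erase (0 : Fin d → ZMod L), F ξ ≤
      ∑ i : Fin d, ∑ j ∈ univ.erase (0 : ZMod L), if ξ ∈ dominatedFreqs i j then F ξ else 0 := by
    intro ξ hξ
    have hξ0 := ne_of_mem_erase hξ
    have hnn : ∀ i (j : ZMod L), 0 ≤ if ξ ∈ dominatedFreqs i j then F ξ else 0 := fun i j => by
      split_ifs
      · exact hF ξ hξ0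
      · exact le_rfl
    have : Nonempty (Fin d) := ⟨⟨0, hd⟩⟩
    obtain ⟨i, -, hi⟩ := exists_max_image (univ : Finset (Fin d))
      (fun i => (ξ i).valMinAbs.natAbs) univ_nonempty
    have hi0 : ξ i ≠ 0 := by
      intro h0
      apply hξ0
      ext1 i'
      have := hi i' (mem_univ _)
      rw [h0, ZMod.valMinAbs_zero] at this
      rw [Pi.zero_apply, ← ZMod.valMinAbs_eq_zero]
      simpa using this
    have hmem : ξ ∈ dominatedFreqs i (ξ i) :=
      mem_filter.2 ⟨mem_univ _, rfl, fun i' => hi i' (mem_univ _)⟩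
    calc F ξ = if ξ ∈ dominatedFreqs i (ξ i) then F ξ else 0 := (if_pos hmem).symm
      _ ≤ ∑ j ∈ univ.erase (0 : ZMod L), if ξ ∈ dominatedFreqs i j then F ξ else 0 :=
        single_le_sum (f := fun j => if ξ ∈ dominatedFreqs i j then F ξ else 0)
          (fun j _ => hnn i j) (mem_erase.2 ⟨hi0, mem_univ _⟩)
      _ ≤ _ := single_le_sum (f := fun i => ∑ j ∈ univ.erase (0 : ZMod L),
          if ξ ∈ dominatedFreqs i j then F ξ else 0)
          (fun i _ => sum_nonneg fun j _ => hnn i j) (mem_univ i)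
  refine (sum_le_sum h1).trans (le_of_eq ?_)
  rw [sum_comm]
  refine sum_congr rfl fun i _ => ?_
  rw [sum_comm]
  refine sum_congr rfl fun j hj => ?_
  rw [← sum_filter]
  refine sum_congr ?_ fun _ _ => rfl
  ext ξ
  simp only [mem_filter, mem_erase, mem_univ, and_true]
  exact ⟨fun h => h.2, fun h => ⟨hne i j (ne_of_mem_erase hj) ξ h, h⟩⟩

lemma abs_torusGreen_le (hd : 3 ≤ d) (s : ℕ) (x : Fin d → ZMod L) :
    |torusGreen L d s x| ≤ (d : ℝ) ^ 2 / 4 * 3 ^ (d - 1) *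
      ((L : ℝ)⁻¹ * ∑ j ∈ univ.erase (0 : ZMod L),
        (1 - 4 / d * ((j.valMinAbs : ℝ) / L) ^ 2) ^ s) := by
  have hd1 : 1 ≤ d := by omega
  have hd0 : (0 : ℝ) < d := by exact_mod_cast hd1
  have hL0 : (0 : ℝ) < L := by exact_mod_cast NeZero.pos L
  have hcard : (Fintype.card (Fin d → ZMod L) : ℝ) = (L : ℝ) ^ d := by simp
  have hFnn : ∀ ξ : Fin d → ZMod L, ξ ≠ 0 → 0 ≤ torusEig ξ ^ s / (1 - torusEig ξ) :=
    fun ξ hξ => div_nonneg (pow_nonneg (torusEig_nonneg hd1 ξ) _)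
      (one_sub_torusEig_pos hd1 hξ).le
  have h1 : |torusGreen L d s x| ≤ ((L : ℝ) ^ d)⁻¹ *
      ∑ ξ ∈ univ.erase (0 : Fin d → ZMod L), torusEig ξ ^ s / (1 - torusEig ξ) := by
    rw [torusGreen, abs_mul, hcard, abs_of_pos (by positivity)]
    refine mul_le_mul_of_nonneg_left ((abs_sum_le_sum_abs _ _).trans ?_) (by positivity)
    refine sum_le_sum fun ξ hξ => ?_
    have := hFnn ξ (ne_of_mem_erase hξ)
    rw [abs_mul, abs_of_nonneg this]
    exact mul_le_of_le_one_right this (abs_torusChar_le _ _)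
  have h2 : ∀ (i : Fin d), ∀ j ∈ univ.erase (0 : ZMod L),
      ∑ ξ ∈ dominatedFreqs i j, torusEig ξ ^ s / (1 - torusEig ξ) ≤
      d / 4 * 3 ^ (d - 1) * (L : ℝ) ^ (d - 1) *
        (1 - 4 / d * ((j.valMinAbs : ℝ) / L) ^ 2) ^ s := by
    intro i j hj
    have hq := sq_valMinAbs_div_pos (ne_of_mem_erase hj)
    set y : ℝ := 4 / d * ((j.valMinAbs : ℝ) / L) ^ 2 with hy
    have hy0 : 0 < y := by positivity
    set A : ℕ := j.valMinAbs.natAbs with hA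
    have hAq : ((j.valMinAbs : ℝ) / L) ^ 2 = (A / L) ^ 2 := by
      rw [div_pow, div_pow, hA, Nat.cast_natAbs, Int.cast_abs, sq_abs]
    have hA1 : 1 ≤ A := by
      rw [hA, Nat.one_le_iff_ne_zero, Int.natAbs_ne_zero, Ne, ZMod.valMinAbs_eq_zero]
      exact ne_of_mem_erase hj
    have hA1' : (1 : ℝ) ≤ A := by exact_mod_cast hA1
    have hAL : (A : ℝ) ≤ L := by
      have := abs_valMinAbs_div_le j
      rw [abs_div, abs_of_pos hL0, div_le_iff₀ hL0] at this
      have h3 : (A : ℝ) = |(j.valMinAbs : ℝ)| := by rw [hA, Nat.cast_natAbs, Int.cast_abs]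
      linarith
    have hterm : ∀ ξ ∈ dominatedFreqs i j, torusEig ξ ^ s / (1 - torusEig ξ) ≤
        (1 - y) ^ s / y := by
      intro ξ hξ
      simp only [dominatedFreqs, mem_filter] at hξ
      have h3 := le_one_sub_torusEig hd1 ξ i
      rw [hξ.2.1, ← hy] at h3
      have h4 := torusEig_nonneg hd1 ξ
      have h5 : torusEig ξ ≤ 1 - y := by linarith
      have h6 : 0 ≤ (1 - y) ^ s := pow_nonneg (h4.trans h5) s
      gcongr
    have hy1 : 0 ≤ 1 - y := by
      have h3 := abs_valMinAbs_div_le j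
      have h4 : ((j.valMinAbs : ℝ) / L) ^ 2 ≤ (1 / 2) ^ 2 := by
        rw [← sq_abs]; gcongr
      have h5 : (4 : ℝ) / d ≤ 4 / 1 := by gcongr; exact_mod_cast hd1
      nlinarith
    have hc : ((dominatedFreqs i j).card : ℝ) ≤ (3 * A) ^ (d - 1) := by
      have h3 : ((dominatedFreqs i j).card : ℝ) ≤ (2 * A + 1) ^ (d - 1) := by
        exact_mod_cast card_dominatedFreqs_le i j
      refine h3.trans ?_
      gcongr
      linarith
    calc _ ≤ (dominatedFreqs i j).card • ((1 - y) ^ s / y) := sum_le_card_nsmul _ _ _ hterm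
      _ ≤ (3 * A) ^ (d - 1) * ((1 - y) ^ s / y) := by
          rw [nsmul_eq_mul]
          gcongr
      _ = d / 4 * 3 ^ (d - 1) * ((A : ℝ) ^ (d - 3) * (L : ℝ) ^ 2) * (1 - y) ^ s := by
          rw [hy, hAq, mul_pow, show d - 1 = (d - 3) + 2 by omega, pow_add (A : ℝ)]
          field_simp
      _ ≤ d / 4 * 3 ^ (d - 1) * ((L : ℝ) ^ (d - 3) * (L : ℝ) ^ 2) * (1 - y) ^ s := by
          gcongr
      _ = _ := by rw [← pow_add, show d - 3 + 2 = d - 1 by omega]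
  refine h1.trans ?_
  have h3 := (sum_le_sum_dominatedFreqs hd1 hFnn).trans
    (sum_le_sum fun i _ => sum_le_sum (h2 i))
  rw [sum_const, card_univ, Fintype.card_fin, nsmul_eq_mul, ← mul_sum] at h3
  refine (mul_le_mul_of_nonneg_left h3 (by positivity)).trans (le_of_eq ?_)
  obtain ⟨m, rfl⟩ : ∃ m, d = m + 1 := ⟨d - 1, by omega⟩
  rw [Nat.add_sub_cancel, pow_succ (L : ℝ)]
  field_simp

/-- The torus of dimension `d ≥ 3` has a Green function which is bounded uniformly in the side
length, and which decays uniformly along the lazy walk. -/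
lemma exists_torusGreen_bound (hd : 3 ≤ d) : ∃ C₀ : ℝ, 0 ≤ C₀ ∧
    (∀ (L : ℕ) [NeZero L] (x : Fin d → ZMod L), |torusGreen L d 0 x| ≤ C₀) ∧
    ∀ ε > 0, ∃ R L₀ : ℕ, ∀ (L : ℕ) [NeZero L], L₀ ≤ L → ∀ s, R ≤ s →
      ∀ x : Fin d → ZMod L, |torusGreen L d s x| ≤ ε := by
  have hd0 : (0 : ℝ) < d := by exact_mod_cast (by omega : 0 < d)
  set K : ℝ := (d : ℝ) ^ 2 / 4 * 3 ^ (d - 1) with hK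
  have hK0 : 0 < K := by positivity
  refine ⟨K, hK0.le, ?_, ?_⟩
  · intro L _ x
    have hL0 : (0 : ℝ) < L := by exact_mod_cast NeZero.pos L
    refine (abs_torusGreen_le hd 0 x).trans ?_
    refine mul_le_of_le_one_right hK0.le ?_
    rw [inv_mul_le_iff₀ hL0]
    simp only [pow_zero, sum_const, nsmul_one, mul_one]
    have : (univ.erase (0 : ZMod L)).card ≤ L :=
      (card_le_card (erase_subset _ _)).trans (by simp)
    exact_mod_cast this
  · intro ε hε
    obtain ⟨ρ, hρ0, hρ1, hρε⟩ : ∃ ρ : ℝ, 0 < ρ ∧ ρ ≤ 1 / 2 ∧ K * (3 * ρ) ≤ ε / 2 := by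
      refine ⟨min (1 / 2) (ε / (6 * K)), by positivity, min_le_left _ _, ?_⟩
      have := min_le_right (1 / 2) (ε / (6 * K))
      rw [le_div_iff₀ (by positivity)] at this
      linarith
    have hd1 : (4 : ℝ) / d ≤ 4 / 1 := by gcongr; exact_mod_cast (by omega : 1 ≤ d)
    have hd4 : (0 : ℝ) < 4 / d := by positivity
    set θ : ℝ := 1 - 4 / d * ρ ^ 2 with hθ
    have hθ0 : 0 ≤ θ := by
      have : ρ ^ 2 ≤ (1 / 2) ^ 2 := by gcongr
      nlinarith
    have hθ1 : θ < 1 := by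
      have : 0 < 4 / d * ρ ^ 2 := by positivity
      linarith
    obtain ⟨R, hR⟩ := exists_pow_lt_of_lt_one (by positivity : 0 < ε / (2 * K)) hθ1
    obtain ⟨L₀, hL₀⟩ := exists_nat_ge (1 / ρ)
    refine ⟨R, L₀, fun L _ hL s hs x => ?_⟩
    have hL0 : (0 : ℝ) < L := by exact_mod_cast NeZero.pos L
    have hLρ : 1 ≤ ρ * L := by
      have h1 : (L₀ : ℝ) ≤ L := by exact_mod_cast hL
      rw [← div_le_iff₀' hρ0]
      linarith
    have hRs : θ ^ s ≤ ε / (2 * K) := (pow_le_pow_of_le_one hθ0 hθ1.le hs).trans hR.le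
    have hterm : ∀ j ∈ univ.erase (0 : ZMod L),
        (1 - 4 / d * ((j.valMinAbs : ℝ) / L) ^ 2) ^ s ≤
          θ ^ s + if j.valMinAbs.natAbs ≤ ⌊ρ * L⌋₊ then 1 else 0 := by
      intro j _
      have h3 : ((j.valMinAbs : ℝ) / L) ^ 2 ≤ (1 / 2) ^ 2 := by
        rw [← sq_abs]; gcongr; exact abs_valMinAbs_div_le j
      have h4 : 0 ≤ 1 - 4 / d * ((j.valMinAbs : ℝ) / L) ^ 2 := by nlinarith
      have h5 : 0 ≤ θ ^ s := pow_nonneg hθ0 s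
      split_ifs with h
      · have h6 : 0 ≤ 4 / d * ((j.valMinAbs : ℝ) / L) ^ 2 := by positivity
        have := pow_le_one₀ (n := s) h4 (by linarith)
        linarith
      · rw [add_zero]
        have h6 : ρ * L < (j.valMinAbs.natAbs : ℝ) := (Nat.floor_lt (by positivity)).1 (by omega)
        rw [Nat.cast_natAbs, Int.cast_abs] at h6
        have h7 : ρ ≤ |(j.valMinAbs : ℝ) / L| := by
          rw [abs_div, abs_of_pos hL0, le_div_iff₀ hL0]
          exact h6.le
        have h8 : ρ ^ 2 ≤ ((j.valMinAbs : ℝ) / L) ^ 2 := by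
          rw [← sq_abs ((j.valMinAbs : ℝ) / L)]; gcongr
        have h9 := mul_le_mul_of_nonneg_left h8 hd4.le
        gcongr
        linarith
    have hsum : ∑ j ∈ univ.erase (0 : ZMod L),
        (1 - 4 / d * ((j.valMinAbs : ℝ) / L) ^ 2) ^ s ≤ L * θ ^ s + 3 * (ρ * L) := by
      refine (sum_le_sum hterm).trans ?_
      rw [sum_add_distrib]
      refine add_le_add ?_ ?_
      · rw [sum_const, nsmul_eq_mul]
        have h9 : ((univ.erase (0 : ZMod L)).card : ℝ) ≤ L := by
          exact_mod_cast (card_le_card (erase_subset _ _)).trans (by simp)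
        have := pow_nonneg hθ0 s
        gcongr
      · rw [← sum_filter, sum_const, nsmul_one]
        have h9 : ((univ.erase (0 : ZMod L)).filter
            fun j => j.valMinAbs.natAbs ≤ ⌊ρ * L⌋₊).card ≤ 2 * ⌊ρ * L⌋₊ + 1 :=
          (card_le_card (filter_subset_filter _ (erase_subset _ _))).trans (card_valMinAbs_le _)
        have h10 : (((univ.erase (0 : ZMod L)).filter
            fun j => j.valMinAbs.natAbs ≤ ⌊ρ * L⌋₊).card : ℝ) ≤ 2 * (⌊ρ * L⌋₊ : ℝ) + 1 := by
          exact_mod_cast h9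
        have h11 := Nat.floor_le (by positivity : 0 ≤ ρ * L)
        linarith
    refine (abs_torusGreen_le hd s x).trans ?_
    rw [← hK]
    calc K * ((L : ℝ)⁻¹ * _) ≤ K * ((L : ℝ)⁻¹ * (L * θ ^ s + 3 * (ρ * L))) := by gcongr
      _ = K * θ ^ s + K * (3 * ρ) := by field_simp
      _ ≤ K * (ε / (2 * K)) + ε / 2 := by gcongr
      _ = ε := by field_simp; norm_num

end TorusGreen

/-- Exponentials with a larger rate eventually dominate affine and slower exponential terms. -/
lemma exists_exp_dominates {a B K g : ℝ} (ha : 0 ≤ a) (hB : 0 ≤ B) (hK : 0 < K) (hg : 0 < g) :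
    ∃ lam : ℝ, 0 < lam ∧ a * lam + B * Real.exp (lam * g) + 1 ≤ K * Real.exp (lam * (6 * g)) := by
  set q : ℝ := (a / g + B + 1) / K with hq
  have hq0 : 0 < q := by positivity
  refine ⟨q / g, by positivity, ?_⟩
  have h1 : q / g * g = q := by field_simp
  have h2 : q / g * (6 * g) = 6 * q := by field_simp
  rw [h1, h2]
  set z := Real.exp q with hz
  have hz1 : 1 ≤ z := Real.one_le_exp hq0.le
  have hzq : q ≤ z := by have := Real.add_one_le_exp q; rw [hz]; linarith
  have h6 : Real.exp (6 * q) = z ^ 6 := by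
    rw [hz, ← Real.exp_nat_mul]; norm_num
  rw [h6]
  have h3 : z ^ 2 ≤ z ^ 6 := pow_le_pow_right₀ hz1 (by norm_num)
  have h4 : K * (q * z) ≤ K * z ^ 6 := by
    apply mul_le_mul_of_nonneg_left _ hK.le
    nlinarith
  have h5 : K * (q * z) = (a / g + B + 1) * z := by rw [hq]; field_simp
  have h7 : a * (q / g) ≤ a / g * z := by
    have : a * (q / g) = a / g * q := by ring
    rw [this]
    exact mul_le_mul_of_nonneg_left hzq (by positivity)
  nlinarith

lemma mem_OmegaK_iff {V : Type*} [Fintype V] {G : SimpleGraph V} {k : ℕ} {x : V → Bool} :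
    x ∈ OmegaK G k ↔ activeSet G (particles x) = ∅ ∧ (particles x).card = k := by
  rw [activeSet_eq_empty_iff]
  simp only [OmegaK, numParticles, Set.mem_ofPred_eq, particles, mem_filter, mem_univ, true_and]
  constructor
  · rintro ⟨h1, h2⟩
    exact ⟨fun u hu v hv huv => h2 u v huv ⟨hu, hv⟩, h1⟩
  · rintro ⟨h1, h2⟩
    exact ⟨h2, fun u v huv h => h1 u h.1 v h.2 huv⟩

/-- Uniform lower bound for the probability of gaining one particle, on a Cayley graph with a
bounded and decaying Green function. -/
theorem exists_creation_bound {c : ℝ} (hc : 0 < c) {D k : ℕ} (hD : 1 ≤ D) (hk : 1 ≤ k) {C₀ : ℝ}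
    (hC₀ : 0 ≤ C₀) :
    ∃ ε : ℝ, 0 < ε ∧ ∀ R : ℕ, ∃ m : ℝ, 0 < m ∧ ∃ n₀ : ℝ, ∀ (V : Type) [AddCommGroup V] [Fintype V]
      (G : SimpleGraph V) (E : Finset V) (r : V → ℝ), E.card = D → (∀ e ∈ E, -e ∈ E) → 0 ∉ E →
      (∀ u v, G.Adj u v ↔ v - u ∈ E) → IsGreen E r → (∀ x, |r x| ≤ C₀) →
      (∀ s, R ≤ s → ∀ x, |(lazyAvg E)^[s] r x| ≤ ε) → n₀ ≤ Fintype.card V →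
      ∀ x ∈ OmegaK G k, ∀ T : ℕ,
        m - 2 / (1 + T * (c / (Fintype.card V : ℝ) ^ 3)) ≤
          trajProb (kcipKernel G (c / Fintype.card V)) x T
            (fun ω => ∃ t : Fin (T + 1), (t : ℕ) < T ∧ ω t ∈ OmegaK G (k + 1)) := by
  have hD0 : (0 : ℝ) < D := by exact_mod_cast hD
  have hk0 : (0 : ℝ) < k := by exact_mod_cast hk
  set γ : ℝ := 1 / (2 * D * (C₀ + 4)) with hγ
  have hγ0 : 0 < γ := by positivity
  set J : ℕ := k + 2 with hJ
  set C : ℝ := 4 * c * D * J + 2 with hC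
  set ε : ℝ := min 1 (γ / (8 * (k ^ 2 * (38 * D)))) with hε
  have hε0 : 0 < ε := by positivity
  have hε1 : ε ≤ 1 := min_le_left _ _
  set σ : ℝ := 38 * D * ε with hσ
  have hσ0 : 0 ≤ σ := by positivity
  have hσγ : (k : ℝ) ^ 2 * σ ≤ γ / 8 := by
    have h1 : ε ≤ γ / (8 * (k ^ 2 * (38 * D))) := min_le_right _ _
    rw [le_div_iff₀ (by positivity)] at h1
    rw [hσ]; linarith
  have hΛ0 : 0 ≤ C * J := by positivity
  obtain ⟨lam, hlam, hdom⟩ := exists_exp_dominates (a := 16 * (D : ℝ) ^ 2 * k ^ 2)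
    (B := C * J * (D * k)) (K := c / (4 * J * (k + 2))) (g := γ / 8) (by positivity) (by positivity)
    (by positivity) (by positivity)
  set Θ : ℝ := Real.exp (lam * (γ - 2 * ((k : ℝ) ^ 2 * σ))) / (k + 2) with hΘ
  have hΘ0 : 0 < Θ := by positivity
  set b : ℝ := c * Θ / (2 * J) with hb
  have hJ0 : (0 : ℝ) < J := by rw [hJ]; positivity
  have hb0 : 0 ≤ b := by positivity
  have hbΛ : 16 * lam * (D : ℝ) ^ 2 * (k : ℝ) ^ 2 +
      C * J * (D * k) * Real.exp (lam * ((k : ℝ) ^ 2 * σ)) + 1 ≤ b / 2 := by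
    have h1 : Real.exp (lam * ((k : ℝ) ^ 2 * σ)) ≤ Real.exp (lam * (γ / 8)) := by gcongr
    have h2 : Real.exp (lam * (6 * (γ / 8))) ≤ Real.exp (lam * (γ - 2 * ((k : ℝ) ^ 2 * σ))) := by
      gcongr; linarith
    have h3 : b / 2 =
        c / (4 * J * (k + 2)) * Real.exp (lam * (γ - 2 * ((k : ℝ) ^ 2 * σ))) := by
      rw [hb, hΘ]; field_simp; ring
    have h4 := mul_le_mul_of_nonneg_left h1 (show 0 ≤ C * J * (D * k) by positivity)
    have h5 := mul_le_mul_of_nonneg_left h2 (show 0 ≤ c / (4 * J * (k + 2)) by positivity)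
    rw [h3]
    linarith
  refine ⟨ε, hε0, fun R => ?_⟩
  set ρ : ℝ := (1 / (2 * D : ℝ)) ^ (R + 1 + 2) with hρ
  have hρ0 : 0 < ρ := by positivity
  set κ : ℝ := ρ / (8 * D * (C₀ + 4) ^ 2) with hκ
  have hκ0 : 0 < κ := by positivity
  set C₂ : ℝ := 3 * D * (C₀ + 5) with hC₂
  have hC₂0 : 0 ≤ C₂ := by positivity
  set M : ℝ := Real.exp (lam * (k + 1)) with hM
  have hM0 : 0 < M := Real.exp_pos _
  refine ⟨Real.exp (lam * (1 - (k : ℝ) ^ 2 * C₂)) / (2 * M), by positivity, ?_⟩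
  set X : ℝ := lam * D * κ * Real.exp (lam * (1 - (k : ℝ) ^ 2 * C₂)) with hX
  have hX0 : 0 < X := by positivity
  have hev : ∀ᶠ n : ℝ in Filter.atTop, ((R + 1 + 2 : ℕ) : ℝ) ≤ n ∧ 4 + 4 * (D : ℝ) ≤ n ∧
      1 ≤ n * ε ∧ 32 * D * (C₀ + 4) ≤ n * ρ ∧
      (1 + 16 * lam * (D : ℝ) ^ 2 * k ^ 2 + C * J * (D * k)) * M ≤ n * X ∧
      2 * (C * J) ≤ n ∧ 2 * c ≤ n ∧ b ≤ n := by
    refine (Filter.eventually_ge_atTop _).and ((Filter.eventually_ge_atTop _).and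
      (((Filter.tendsto_id.atTop_mul_const hε0).eventually_ge_atTop _).and
      (((Filter.tendsto_id.atTop_mul_const hρ0).eventually_ge_atTop _).and
      (((Filter.tendsto_id.atTop_mul_const hX0).eventually_ge_atTop _).and
      ((Filter.eventually_ge_atTop _).and ((Filter.eventually_ge_atTop _).and
      (Filter.eventually_ge_atTop _)))))))
  obtain ⟨n₀, hn₀⟩ := Filter.eventually_atTop.1 hev
  refine ⟨n₀, fun V _ _ G E r hED hEn h0 hG hr hrC hR hn x hx T => ?_⟩
  obtain ⟨n1, n2, n3, n4, n5, n6, n7, n8⟩ := hn₀ _ hn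
  have hE : E.Nonempty := Finset.card_pos.1 (by omega)
  subst hED
  obtain ⟨H, Hev, H0, HC, H3, Hneg, Hκ, Hfar, e₀, he₀, e₁, he₁, hne, hnE, Hγ⟩ :=
    hr.exists_creation_potential (R := R + 1) (κ := κ) hE hEn h0 hrC hε1
      (fun s hs => hR s (by omega)) (by exact_mod_cast n1) n2 (by linarith)
      (by rw [hκ, div_mul_cancel₀ _ (by positivity)]) (by linarith)
  have hfar : ∀ x, heat E (R + 1 + 2) x = 0 → H x ≤ σ ∧ (∀ e ∈ E, H (x + e) ≤ σ) ∧
      ∀ e ∈ E, ∀ e' ∈ E, H (x + e + e') ≤ σ := fun x hx =>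
    ⟨(Hfar x hx).1, fun e he => ((Hfar x hx).2 e he).1, fun e he => ((Hfar x hx).2 e he).2⟩
  obtain ⟨hxs, hxk⟩ := mem_OmegaK_iff.1 hx
  have key := trajProb_hit_of_drift (G := G) (f := creationFn H lam k) (J := J) (D := E.card)
    (C := C) (b := b) (Θ := Θ) (c := c) (fun X => creationFn_nonneg X) (M := M)
    (fun X => creationFn_le H0 hlam.le X) hM0 hc (fun u => (card_adj_eq hG u).le) hC hb0
    (by rw [hb]; field_simp; rfl) n6 n7 n8
    {S | activeSet G S = ∅ ∧ S.card = k + 1} ?_ x hxs (by omega) T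
  · have h1 := le_creationFn (lam := lam) (k := k) hC₂0 HC hlam.le (S := particles x)
      (by omega) (by omega)
    have h2 := div_le_div_of_nonneg_right h1 (show 0 ≤ 2 * M by positivity)
    simp only [mem_OmegaK_iff]
    simp only [Set.mem_ofPred_eq] at key
    linarith
  · intro S hS hSA hf
    have hcard : 1 ≤ S.card ∧ S.card ≤ k + 1 := by
      by_contra hcon
      rw [creationFn, if_neg hcon] at hf
      exact lt_irrefl _ hf
    have hSk : S.card ≤ k := by
      have : S.card ≠ k + 1 := fun h => hSA ⟨hS, h⟩
      omega
    refine ⟨by omega, ?_⟩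
    exact creationFn_drift hE hEn hG (R := R + 1 + 2) (by omega) hlam.le Hev H0 hC₂0 HC H3 Hneg Hκ
      hσ0 hfar he₀ he₁ hne hnE Hγ hΛ0 hb0 hbΛ n5 hS hcard.1 hSk

/-- Uniform lower bound for the probability of losing one particle, on a Cayley graph with a
bounded and decaying Green function. -/
theorem exists_annihilation_bound {c : ℝ} (hc : 0 < c) {D k : ℕ} (hD : 1 ≤ D) (hk : 2 ≤ k) {C₀ : ℝ}
    (hC₀ : 0 ≤ C₀) :
    ∃ ε : ℝ, 0 < ε ∧ ∀ R : ℕ, ∃ m : ℝ, 0 < m ∧ ∃ n₀ : ℝ, ∀ (V : Type) [AddCommGroup V] [Fintype V]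
      (G : SimpleGraph V) (E : Finset V) (r : V → ℝ), E.card = D → (∀ e ∈ E, -e ∈ E) →
      (∀ u v, G.Adj u v ↔ v - u ∈ E) → IsGreen E r → (∀ x, |r x| ≤ C₀) →
      (∀ s, R ≤ s → ∀ x, |(lazyAvg E)^[s] r x| ≤ ε) → n₀ ≤ Fintype.card V →
      ∀ x ∈ OmegaK G k, ∀ T : ℕ,
        m - 2 / (1 + T * (c / (Fintype.card V : ℝ) ^ 3)) ≤
          trajProb (kcipKernel G (c / Fintype.card V)) x T
            (fun ω => ∃ t : Fin (T + 1), (t : ℕ) < T ∧ ω t ∈ OmegaK G (k - 1)) := by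
  have hD0 : (0 : ℝ) < D := by exact_mod_cast hD
  have hk0 : (0 : ℝ) < k := by exact_mod_cast (by omega : 0 < k)
  set J : ℕ := k + 1 with hJ
  set C : ℝ := 4 * c * D * J + 2 with hC
  have hΛ0 : 0 ≤ C * J := by positivity
  set ε : ℝ := 2 * D / ((C * J * (D * k) + 1) * (k ^ 2 * 3)) with hε
  have hε0 : 0 < ε := by positivity
  set σ : ℝ := 3 * ε with hσ
  have hσ0 : 0 ≤ σ := by positivity
  have hΛσ : (C * J * (D * k) + 1) * ((k : ℝ) ^ 2 * σ) ≤ 2 * D := by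
    rw [hσ, hε]; apply le_of_eq; field_simp
  set M : ℝ := 2 * C₀ + 3 * ε + 2 with hM
  have hM0 : 0 < M := by positivity
  set B : ℝ := (k : ℝ) ^ 2 * M * (k * (k + 1)) with hB
  have hB0 : 0 < B := by positivity
  have hkB : (k : ℝ) ^ 2 * M ≤ B := by
    rw [hB]
    apply le_mul_of_one_le_right (by positivity)
    have : (1 : ℝ) ≤ k := by exact_mod_cast (by omega : 1 ≤ k)
    nlinarith
  refine ⟨ε, hε0, fun R => ?_⟩
  set ρ : ℝ := D * (1 / (2 * D : ℝ)) ^ (R + 1 + 1) with hρ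
  have hρ0 : 0 < ρ := by positivity
  refine ⟨ε / 2 / (2 * B), by positivity, ?_⟩
  have hev : ∀ᶠ n : ℝ in Filter.atTop, ((R + 1 + 1 : ℕ) : ℝ) ≤ n ∧
      (C * J * (D * k) + 1) * B ≤ n * ρ ∧ 2 * (C * J) ≤ n ∧ 2 * c ≤ n :=
    (Filter.eventually_ge_atTop _).and
      (((Filter.tendsto_id.atTop_mul_const hρ0).eventually_ge_atTop _).and
      ((Filter.eventually_ge_atTop _).and (Filter.eventually_ge_atTop _)))
  obtain ⟨n₀, hn₀⟩ := Filter.eventually_atTop.1 hev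
  refine ⟨n₀, fun V _ _ G E r hED hEn hG hr hrC hR hn x hx T => ?_⟩
  obtain ⟨n1, n2, n3, n4⟩ := hn₀ _ hn
  have hE : E.Nonempty := Finset.card_pos.1 (by omega)
  subst hED
  obtain ⟨h, hev, hlow, hle, hdiff, hfar⟩ :=
    hr.exists_annihilation_potential (R := R + 1) (ε := ε) hE hEn hrC
      (fun x => hR _ (by omega) x) (by exact_mod_cast n1)
  have h0 : ∀ x, 0 ≤ h x := fun x => hε0.le.trans (hlow x)
  obtain ⟨hxs, hxk⟩ := mem_OmegaK_iff.1 hx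
  have key := trajProb_hit_of_drift (G := G) (f := annihilationFn h k B) (J := J) (D := E.card)
    (C := C) (b := 0) (Θ := 0) (c := c) (fun X => annihilationFn_nonneg h0 hB0.le X) (M := B)
    (fun X => annihilationFn_le hM0.le hle hkB X) hB0 hc (fun u => (card_adj_eq hG u).le) hC le_rfl
    (by simp) n3 n4 (Nat.cast_nonneg _)
    {S | activeSet G S = ∅ ∧ S.card + 1 = k} ?_ x hxs (by omega) T
  · have h1 : ε / 2 ≤ annihilationFn h k B (particles x) := by
      rw [annihilationFn, if_pos hxk, pairEnergy]
      obtain ⟨u, hu, v, hv, huv⟩ := Finset.one_lt_card.1 (by omega : 1 < (particles x).card)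
      have h2 : h (u - v) ≤ ∑ w ∈ (particles x).erase u, h (u - w) :=
        single_le_sum (f := fun w => h (u - w)) (fun w _ => h0 _)
          (mem_erase.2 ⟨huv.symm, hv⟩)
      have h3 : ∑ w ∈ (particles x).erase u, h (u - w) ≤
          ∑ u ∈ particles x, ∑ w ∈ (particles x).erase u, h (u - w) :=
        single_le_sum (f := fun u => ∑ w ∈ (particles x).erase u, h (u - w))
          (fun u _ => sum_nonneg fun w _ => h0 _) hu
      have := hlow (u - v)
      linarith
    have h2 := div_le_div_of_nonneg_right h1 (show 0 ≤ 2 * B by positivity)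
    have hiff : ∀ y : V → Bool, y ∈ OmegaK G (k - 1) ↔
        activeSet G (particles y) = ∅ ∧ (particles y).card + 1 = k := fun y => by
      rw [mem_OmegaK_iff]
      refine and_congr_right fun _ => ?_
      omega
    simp only [hiff]
    simp only [Set.mem_ofPred_eq] at key
    linarith
  · intro S hS hSA hf
    have hSk : S.card = k := by
      by_contra hcon
      have h2 : ¬ S.card + 1 = k := fun h => hSA ⟨hS, h⟩
      simp [annihilationFn, hcon, h2] at hf
    refine ⟨by omega, ?_⟩
    simp only [zero_mul, ite_self, add_zero]
    exact annihilationFn_drift hE hEn hG (R := R + 1 + 1) (by omega) hk hev h0 hM0.le hle hdiff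
      hσ0 hfar hB hΛ0 hΛσ n2 hS hSk

/-- A lower bound of the form `m - 2 / (1 + T c / n³)` for the probability of hitting a set before
every time `T` gives a hitting probability above `m / 4` before time `4 / (m c) n³`. -/
lemma lt_trajProb_of_hit_bound {V : Type} [Fintype V] [DecidableEq V] {G : SimpleGraph V} {c : ℝ}
    (hc : 0 < c) {n : ℕ} (hn : Fintype.card V = n) (hn0 : 0 < n) {x : V → Bool}
    {A : Set (V → Bool)} {m m' : ℝ} (hm : 0 < m) (hmm : m ≤ m')
    (h : ∀ T : ℕ, m' - 2 / (1 + T * (c / (Fintype.card V : ℝ) ^ 3)) ≤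
      trajProb (kcipKernel G (c / Fintype.card V)) x T
        (fun ω => ∃ t : Fin (T + 1), (t : ℕ) < T ∧ ω t ∈ A)) :
    trajProb (kcipKernel G (c / (n : ℝ))) x ⌈4 / (m * c) * (n : ℝ) ^ 3⌉₊
      (fun ω => ∃ t : Fin (⌈4 / (m * c) * (n : ℝ) ^ 3⌉₊ + 1),
        (t : ℝ) < 4 / (m * c) * (n : ℝ) ^ 3 ∧ ω t ∈ A) > m / 4 := by
  subst hn
  set n : ℝ := (Fintype.card V : ℝ) with hndef
  have hn0 : 0 < n := by rw [hndef]; exact_mod_cast hn0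
  have hT := h ⌈4 / (m * c) * n ^ 3⌉₊
  simp only [Nat.lt_ceil] at hT
  refine lt_of_lt_of_le ?_ hT
  have h1 : 4 / (m * c) * n ^ 3 ≤ (⌈4 / (m * c) * n ^ 3⌉₊ : ℝ) := Nat.le_ceil _
  have h2 : 4 / m ≤ (⌈4 / (m * c) * n ^ 3⌉₊ : ℝ) * (c / n ^ 3) := by
    calc 4 / m = 4 / (m * c) * n ^ 3 * (c / n ^ 3) := by field_simp
      _ ≤ _ := mul_le_mul_of_nonneg_right h1 (by positivity)
  have h3 : 2 / (1 + (⌈4 / (m * c) * n ^ 3⌉₊ : ℝ) * (c / n ^ 3)) ≤ m / 2 := by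
    rw [div_le_div_iff₀ (by positivity) (by positivity)]
    have h4 := mul_le_mul_of_nonneg_left h2 hm.le
    rw [mul_div_cancel₀ _ hm.ne'] at h4
    nlinarith
  linarith

/-- A property of Cayley graphs with a bounded and decaying Green function holds on all large tori
of dimension `d ≥ 3`. -/
lemma exists_torus_bound {d : ℕ} (hd : 3 ≤ d)
    {P : ∀ (V : Type) [Fintype V], SimpleGraph V → ℝ → Prop}
    (hP : ∀ C₀ : ℝ, 0 ≤ C₀ → ∃ ε : ℝ, 0 < ε ∧ ∀ R : ℕ, ∃ m : ℝ, 0 < m ∧ ∃ n₀ : ℝ,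
      ∀ (V : Type) [AddCommGroup V] [Fintype V] (G : SimpleGraph V) (E : Finset V) (r : V → ℝ),
        E.card = 2 * d → (∀ e ∈ E, -e ∈ E) → 0 ∉ E → (∀ u v, G.Adj u v ↔ v - u ∈ E) →
        IsGreen E r → (∀ x, |r x| ≤ C₀) → (∀ s, R ≤ s → ∀ x, |(lazyAvg E)^[s] r x| ≤ ε) →
        n₀ ≤ Fintype.card V → P V G m) :
    ∃ m : ℝ, 0 < m ∧ ∃ L₀ : ℕ, ∀ L : ℕ, L₀ ≤ L →
      P (Fin d → ZMod (L + 1)) (torusGraph (L + 1) d) m := by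
  obtain ⟨C₀, hC₀, hbd, hdecay⟩ := exists_torusGreen_bound hd
  obtain ⟨ε, hε, hR⟩ := hP C₀ hC₀
  obtain ⟨R, L₁, hL₁⟩ := hdecay ε hε
  obtain ⟨m, hm, n₀, hn₀⟩ := hR R
  refine ⟨m, hm, max 3 (max L₁ ⌈n₀⌉₊), fun L hL => ?_⟩
  have hL3 : 3 ≤ L + 1 := by have := le_max_left 3 (max L₁ ⌈n₀⌉₊); omega
  have hLL : max L₁ ⌈n₀⌉₊ ≤ L := (le_max_right _ _).trans hL
  have hLL₁ : L₁ ≤ L + 1 := by have := le_max_left L₁ ⌈n₀⌉₊; omega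
  refine hn₀ _ _ (torusSteps (L + 1) d) (torusGreen (L + 1) d 0) (card_torusSteps hL3)
    (fun e he => neg_mem_torusSteps he) (zero_notMem_torusSteps hL3) (torusGraph_adj hL3)
    (isGreen_torusGreen hL3 (by omega)) (hbd _) (fun s hs x => ?_) ?_
  · rw [iterate_lazyAvg_torusGreen hL3 (by omega)]
    exact hL₁ _ hLL₁ s hs x
  · have h1 : n₀ ≤ (L + 1 : ℕ) := (Nat.le_ceil n₀).trans (by
      have := le_max_right L₁ ⌈n₀⌉₊
      exact_mod_cast (by omega : ⌈n₀⌉₊ ≤ L + 1))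
    have h2 : L + 1 ≤ (L + 1) ^ d := Nat.le_self_pow (by omega) _
    simp only [Fintype.card_fun, ZMod.card, Fintype.card_fin]
    exact h1.trans (by exact_mod_cast h2)

/-- Fix `0 < c`, `d ≥ 3` and `k ≥ 1`. There exist `δ > 0` and `ε > 0`
(depending only on `c, d, k`) such that for all `n = (L+1)^d` sufficiently large, for the KCIP
on `Λ(L+1,d)` with `p = c/n` started from any `x ∈ Ω_k`:
`P[ρ_{k+1} < εn³ | X_0 = x] > δ`, and, if `k ≥ 2`, also `P[ρ_{k−1} < εn³ | X_0 = x] > δ`,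
where `ρ_j = inf {t : X_t ∈ Ω_j}` (so `ρ_j < εn³` iff some time `t < εn³` has `X_t ∈ Ω_j`). -/
theorem kcip_transition_between_levels (c : ℝ) (hc : 0 < c) (d : ℕ) (hd : 3 ≤ d)
    (k : ℕ) (hk : 1 ≤ k) :
    ∃ δ ε : ℝ, 0 < δ ∧ 0 < ε ∧ ∃ N : ℕ,
      ∀ L : ℕ, N < (L + 1) ^ d →
      ∀ x : (Fin d → ZMod (L + 1)) → Bool, x ∈ OmegaK (torusGraph (L + 1) d) k →
        (trajProb (kcipKernel (torusGraph (L + 1) d) (c / (((L + 1) ^ d : ℕ) : ℝ))) x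
            (⌈ε * (((L + 1) ^ d : ℕ) : ℝ) ^ 3⌉₊)
            (fun ω => ∃ t : Fin (⌈ε * (((L + 1) ^ d : ℕ) : ℝ) ^ 3⌉₊ + 1),
              (t : ℝ) < ε * (((L + 1) ^ d : ℕ) : ℝ) ^ 3 ∧
                ω t ∈ OmegaK (torusGraph (L + 1) d) (k + 1)) > δ) ∧
        (2 ≤ k →
          trajProb (kcipKernel (torusGraph (L + 1) d) (c / (((L + 1) ^ d : ℕ) : ℝ))) x
              (⌈ε * (((L + 1) ^ d : ℕ) : ℝ) ^ 3⌉₊)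
              (fun ω => ∃ t : Fin (⌈ε * (((L + 1) ^ d : ℕ) : ℝ) ^ 3⌉₊ + 1),
                (t : ℝ) < ε * (((L + 1) ^ d : ℕ) : ℝ) ^ 3 ∧
                  ω t ∈ OmegaK (torusGraph (L + 1) d) (k - 1)) > δ) := by
  obtain ⟨m₁, hm₁, L₁, hup⟩ := exists_torus_bound hd
    (P := fun V _ G m => ∀ x ∈ OmegaK G k, ∀ T : ℕ,
      m - 2 / (1 + T * (c / (Fintype.card V : ℝ) ^ 3)) ≤
        trajProb (kcipKernel G (c / Fintype.card V)) x T
          (fun ω => ∃ t : Fin (T + 1), (t : ℕ) < T ∧ ω t ∈ OmegaK G (k + 1)))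
    (fun C₀ hC₀ => exists_creation_bound hc (by omega) hk hC₀)
  obtain ⟨m₂, hm₂, L₂, hdown⟩ := exists_torus_bound hd
    (P := fun V _ G m => 2 ≤ k → ∀ x ∈ OmegaK G k, ∀ T : ℕ,
      m - 2 / (1 + T * (c / (Fintype.card V : ℝ) ^ 3)) ≤
        trajProb (kcipKernel G (c / Fintype.card V)) x T
          (fun ω => ∃ t : Fin (T + 1), (t : ℕ) < T ∧ ω t ∈ OmegaK G (k - 1)))
    (fun C₀ hC₀ => by
      by_cases hk2 : 2 ≤ k
      · obtain ⟨ε, hε, h⟩ := exists_annihilation_bound hc (by omega : 1 ≤ 2 * d) hk2 hC₀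
        refine ⟨ε, hε, fun R => ?_⟩
        obtain ⟨m, hm, n₀, h⟩ := h R
        exact ⟨m, hm, n₀, fun V _ _ G E r h1 h2 _ h3 h4 h5 h6 h7 _ =>
          h V G E r h1 h2 h3 h4 h5 h6 h7⟩
      · exact ⟨1, one_pos, fun R => ⟨1, one_pos, 0, fun V _ _ G E r _ _ _ _ _ _ _ _ h =>
          absurd h hk2⟩⟩)
  have hm : 0 < min m₁ m₂ := lt_min hm₁ hm₂
  refine ⟨min m₁ m₂ / 4, 4 / (min m₁ m₂ * c), by positivity, by positivity,
    (max L₁ L₂ + 1) ^ d, fun L hL x hx => ?_⟩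
  have hL' : max L₁ L₂ < L := by
    have := lt_of_pow_lt_pow_left₀ d (Nat.zero_le _) hL
    omega
  have hcard : Fintype.card (Fin d → ZMod (L + 1)) = (L + 1) ^ d := by
    simp only [Fintype.card_fun, ZMod.card, Fintype.card_fin]
  have hpos : 0 < (L + 1) ^ d := by positivity
  refine ⟨?_, fun hk2 => ?_⟩
  · have h := hup L ((le_max_left _ _).trans hL'.le) x hx
    refine lt_trajProb_of_hit_bound hc hcard hpos hm (min_le_left _ _) fun T => ?_
    convert h T
  · have h := hdown L ((le_max_right _ _).trans hL'.le) hk2 x hx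
    refine lt_trajProb_of_hit_bound hc hcard hpos hm (min_le_right _ _) fun T => ?_
    convert h T
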